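/- arXiv:0903.1099 — 3 statements merged into one kernel-verified Lean document; each statement's English description precedes it below -/
import Mathlib

section
/- Let R be an almost perfect domain with Q ≠ R. An R-module M is flat if and only if M is torsion-free and the projective dimension of M is at most 1. -/
universe u

/-- `f : P →ₗ[R] M` is a projective cover of `M`. -/
def IsProjectiveCover (R : Type u) [CommRing R] {P M : Type u}
    [AddCommGroup P] [Module R P] [AddCommGroup M] [Module R M] (f : P →ₗ[R] M) : Prop :=
  Module.Projective R P ∧ Function.Surjective f ∧
    ∀ N : Submodule R P, N ⊔ LinearMap.ker f = ⊤ → N = ⊤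

/-- A commutative ring is perfect iff every module has a projective cover. -/
def IsPerfectRing (R : Type u) [CommRing R] : Prop :=
  ∀ (M : Type u) (_ : AddCommGroup M) (_ : Module R M),
    ∃ (P : Type u) (_ : AddCommGroup P) (_ : Module R P) (f : P →ₗ[R] M),
      IsProjectiveCover R f

/-- An almost perfect domain: an integral domain such that every proper quotient is perfect. -/
def IsAPD (R : Type u) [CommRing R] [IsDomain R] : Prop :=
  ∀ I : Ideal R, I ≠ ⊥ → IsPerfectRing (R ⧸ I)
open CategoryTheory Limits

/-- `InjDimLE R n M` : the injective dimension of `M` is at most `n`. -/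
def InjDimLE (R : Type u) [CommRing R] : ℕ → ModuleCat.{u} R → Prop
  | 0, M => Injective M
  | n + 1, M => ∃ (E : ModuleCat.{u} R) (f : M ⟶ E),
      Mono f ∧ Injective E ∧ InjDimLE R n (cokernel f)

/-- `ProjDimLE R n M` : the projective dimension of `M` is at most `n`. -/
def ProjDimLE (R : Type u) [CommRing R] : ℕ → ModuleCat.{u} R → Prop
  | 0, M => Projective M
  | n + 1, M => ∃ (P : ModuleCat.{u} R) (f : P ⟶ M),
      Epi f ∧ Projective P ∧ ProjDimLE R n (kernel f)

/-- `FlatDimLE R n M` : the flat (weak) dimension of `M` is at most `n`. -/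
def FlatDimLE (R : Type u) [CommRing R] : ℕ → ModuleCat.{u} R → Prop
  | 0, M => Module.Flat R M
  | n + 1, M => ∃ (P : ModuleCat.{u} R) (f : P ⟶ M),
      Epi f ∧ Module.Flat R P ∧ FlatDimLE R n (kernel f)

/-- An `R`-module is divisible if `rM = M` for every nonzero `r : R`. -/
def IsDivisibleModule (R : Type u) [CommRing R] (M : Type u) [AddCommGroup M] [Module R M] :
    Prop :=
  ∀ r : R, r ≠ 0 → ∀ m : M, ∃ x : M, r • x = m


section PerfectRing

variable {S : Type u} [CommRing S]


/-- Coordinates of an element of a projective module with `J P = P`. -/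
lemma apd_proj_zero {P : Type u} [AddCommGroup P] [Module S P] [Module.Projective S P]
    (h : ((Ideal.jacobson (⊥ : Ideal S)) • ⊤ : Submodule S P) = ⊤) (x : P) : x = 0 := by
  obtain ⟨s, hs⟩ := Module.projective_def'.1 (inferInstance : Module.Projective S P)
  have hs' : ∀ p, Finsupp.linearCombination S id (s p) = p := fun p => LinearMap.congr_fun hs p
  have hJ : ∀ p q, s p q ∈ (Ideal.jacobson (⊥ : Ideal S)) := by
    intro p q
    have hp : p ∈ ((Ideal.jacobson (⊥ : Ideal S)) • ⊤ : Submodule S P) := by rw [h]; trivial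
    refine Submodule.smul_induction_on hp ?_ ?_
    · intro r hr n _
      rw [map_smul, Finsupp.smul_apply, smul_eq_mul]
      exact Ideal.mul_mem_right _ _ hr
    · intro a b ha hb
      rw [map_add, Finsupp.add_apply]
      exact Ideal.add_mem _ ha hb
  set a := s x with ha
  let A : Ideal S := Ideal.span (a '' (a.support : Set P))
  have hmem : ∀ q, a q ∈ A := by
    intro q
    by_cases hq : a q = 0
    · rw [hq]; exact A.zero_mem
    · exact Ideal.subset_span ⟨q, by simpa using hq, rfl⟩
  have hA : A ≤ (Ideal.jacobson (⊥ : Ideal S)) • A := by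
    refine Ideal.span_le.2 ?_
    rintro _ ⟨q, -, rfl⟩
    have e : a q = ∑ p ∈ a.support, a p * s p q := by
      have := congrArg (fun z => s z q) (hs' x)
      simp only [Finsupp.linearCombination_apply, Finsupp.sum, map_sum, map_smul, id] at this
      rw [ha, ← this]
      simp [Finsupp.finsetSum_apply]
    show a q ∈ _
    rw [e]
    refine Ideal.sum_mem _ fun p _ => ?_
    rw [mul_comm, ← smul_eq_mul]
    exact Submodule.smul_mem_smul (hJ p q) (hmem p)
  have hfg : A.FG := Submodule.fg_span ((Finset.finite_toSet _).image _)
  have hb := Submodule.eq_bot_of_le_smul_of_le_jacobson_bot _ _ hfg hA le_rfl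
  have a0 : a = 0 := by
    ext q
    have := hmem q
    rw [hb] at this
    simpa using this
  rw [← hs' x, ← ha, a0, map_zero]

/-- A projective module: if all functionals send `x` into `J` then `x ∈ J P`. -/
lemma apd_mem_of_dual {P : Type u} [AddCommGroup P] [Module S P] [Module.Projective S P]
    (I : Ideal S) (x : P) (h : ∀ φ : P →ₗ[S] S, φ x ∈ I) : x ∈ (I • ⊤ : Submodule S P) := by
  obtain ⟨s, hs⟩ := Module.projective_def'.1 (inferInstance : Module.Projective S P)
  have hs' : Finsupp.linearCombination S id (s x) = x := LinearMap.congr_fun hs x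
  rw [← hs', Finsupp.linearCombination_apply]
  refine Submodule.sum_mem _ fun p _ => Submodule.smul_mem_smul ?_ trivial
  exact h (Finsupp.lapply p ∘ₗ s)

lemma apd_smul_top {P : Type u} [AddCommGroup P] [Module S P] (I : Ideal S) (x : P)
    (hx : x ∈ (I • ⊤ : Submodule S P)) :
    ∃ c : P →₀ S, (∀ i, c i ∈ I) ∧ ∑ p ∈ c.support, c p • p = x := by
  have : (⊤ : Submodule S P) = Submodule.span S (Set.range (id : P → P)) := by simp
  rw [this] at hx
  obtain ⟨c, hc, h⟩ := (Submodule.mem_ideal_smul_span_iff_exists_sum I id x).1 hx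
  exact ⟨c, hc, h⟩

lemma apd_superfluous {P : Type u} [AddCommGroup P] [Module S P] [Module.Projective S P]
    (K : Submodule S P) (hK : ∀ N : Submodule S P, N ⊔ K = ⊤ → N = ⊤) :
    K ≤ ((Ideal.jacobson (⊥ : Ideal S)) • ⊤ : Submodule S P) := by
  intro x hx
  refine apd_mem_of_dual _ _ fun φ => ?_
  rw [Ideal.jacobson, Ideal.mem_sInf]
  rintro m ⟨-, hm⟩
  by_contra hφ
  have h1 : Submodule.comap φ m ⊔ K = ⊤ := by
    rw [eq_top_iff]
    intro p _
    obtain ⟨t, i, hi, ht⟩ := hm.exists_inv hφ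
    refine Submodule.mem_sup.2 ⟨p - (φ p * t) • x, ?_, (φ p * t) • x, K.smul_mem _ hx, by abel⟩
    rw [Submodule.mem_comap, map_sub, map_smul, smul_eq_mul]
    have : φ p - φ p * t * φ x = φ p * i := by
      linear_combination (-φ p) * ht
    rw [this]
    exact m.mul_mem_left _ hi
  have h2 := hK _ h1
  have : x ∈ Submodule.comap φ m := by rw [h2]; trivial
  exact hφ this


/-- Nakayama for arbitrary modules over a perfect ring. -/
lemma apd_nakayama (hS : IsPerfectRing S) {N : Type u} [AddCommGroup N] [Module S N]
    (h : ((Ideal.jacobson (⊥ : Ideal S)) • ⊤ : Submodule S N) = ⊤) (x : N) : x = 0 := by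
  obtain ⟨P, _, _, f, hP, hf, hK⟩ := hS N inferInstance inferInstance
  have : ((Ideal.jacobson (⊥ : Ideal S)) • ⊤ : Submodule S P) = ⊤ := by
    apply hK
    have : Submodule.map f ((Ideal.jacobson (⊥ : Ideal S)) • ⊤ : Submodule S P) = ⊤ := by
      rw [Submodule.map_smul'', Submodule.map_top, LinearMap.range_eq_top.2 hf, h]
    rw [← Submodule.comap_map_eq, this, Submodule.comap_top]
  obtain ⟨p, rfl⟩ := hf x
  rw [apd_proj_zero this p, map_zero]

/-- A submodule with `J N = N`. -/
lemma apd_nakayama_sub (hS : IsPerfectRing S) {N : Type u} [AddCommGroup N] [Module S N] (K : Submodule S N)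
    (h : K ≤ (Ideal.jacobson (⊥ : Ideal S)) • K) : K = ⊥ := by
  have h1 : ((Ideal.jacobson (⊥ : Ideal S)) • ⊤ : Submodule S K) = ⊤ := by
    apply Submodule.map_injective_of_injective K.injective_subtype
    rw [Submodule.map_smul'', Submodule.map_top, Submodule.range_subtype]
    exact le_antisymm Submodule.smul_le_right h
  rw [eq_bot_iff]
  intro x hx
  have := apd_nakayama hS h1 ⟨x, hx⟩
  simpa using congrArg Subtype.val this

/-- A flat module over a perfect ring is projective. -/
lemma apd_flat_projective (hS : IsPerfectRing S) (N : Type u) [AddCommGroup N] [Module S N] [Module.Flat S N] :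
    Module.Projective S N := by
  obtain ⟨P, _, _, f, hP, hf, hK⟩ := hS N inferInstance inferInstance
  have hKJ := apd_superfluous _ hK
  have hK0 : LinearMap.ker f = ⊥ := by
    apply apd_nakayama_sub hS
    intro x hx
    obtain ⟨c, hc, hcx⟩ := apd_smul_top (Ideal.jacobson (⊥ : Ideal S)) x (hKJ hx)
    have h0 : ∑ i : c.support, c i • f i = 0 := by
      have h1 : f x = 0 := hx
      rw [← hcx, map_sum] at h1
      rw [Finset.sum_coe_sort c.support (fun p => c p • f p)]
      simpa using h1
    obtain ⟨k, a, y, h2, h3⟩ := Module.Flat.isTrivialRelation_of_sum_smul_eq_zero h0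
    choose q hq using fun j => hf (y j)
    have h4 : x = ∑ i : c.support, c i • ((i : P) - ∑ j, a i j • q j) := by
      simp only [smul_sub, Finset.sum_sub_distrib, Finset.smul_sum, smul_smul]
      rw [Finset.sum_comm]
      simp only [← Finset.sum_smul, h3]
      rw [Finset.sum_coe_sort c.support (fun p => c p • p), hcx]
      simp
    rw [h4]
    refine Submodule.sum_mem _ fun i _ => Submodule.smul_mem_smul (hc i) ?_
    have h2i : f i = ∑ j, a i j • y j := h2 i
    rw [LinearMap.mem_ker, map_sub, h2i]
    simp [hq]
  exact Module.Projective.of_equiv (LinearEquiv.ofBijective f ⟨LinearMap.ker_eq_bot.1 hK0, hf⟩)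

/-- T-nilpotence. -/
lemma apd_tnil (hS : IsPerfectRing S) (j : ℕ → S) (hj : ∀ n, j n ∈ (Ideal.jacobson (⊥ : Ideal S))) : ∃ n, ∏ i ∈ Finset.range n, j i = 0 := by
  let G : Submodule S (ℕ → S) :=
    { carrier := {g | ∃ n, ∀ m, n ≤ m → g m = 0}
      add_mem' := by
        rintro a b ⟨n, hn⟩ ⟨n', hn'⟩
        refine ⟨max n n', fun m hm => ?_⟩
        simp [hn m (le_trans (le_max_left _ _) hm), hn' m (le_trans (le_max_right _ _) hm)]
      zero_mem' := ⟨0, fun _ _ => rfl⟩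
      smul_mem' := by
        rintro c a ⟨n, hn⟩
        exact ⟨n, fun m hm => by simp [hn m hm]⟩ }
  let w : ℕ → ((ℕ → S) ⧸ G) := fun k => G.mkQ fun n => ∏ i ∈ Finset.Ico k n, j i
  have hw : ∀ k, w k = j k • w (k + 1) := by
    intro k
    simp only [w]
    rw [← map_smul, ← sub_eq_zero, ← map_sub]
    refine (Submodule.Quotient.mk_eq_zero _).2 ⟨k + 1, fun m hm => ?_⟩
    simp [Finset.prod_eq_prod_Ico_succ_bot (show k < m by omega)]
  have h0 : Submodule.span S (Set.range w) = ⊥ := by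
    apply apd_nakayama_sub hS
    refine Submodule.span_le.2 ?_
    rintro _ ⟨k, rfl⟩
    rw [hw]
    exact Submodule.smul_mem_smul (hj k) (Submodule.subset_span ⟨_, rfl⟩)
  have h1 : w 0 = 0 := by
    have : w 0 ∈ Submodule.span S (Set.range w) := Submodule.subset_span ⟨_, rfl⟩
    rw [h0] at this
    simpa using this
  obtain ⟨n, hn⟩ := (Submodule.Quotient.mk_eq_zero G).1 h1
  exact ⟨n, by simpa using hn n le_rfl⟩

lemma apd_nil (hS : IsPerfectRing S) {a : S} (ha : a ∈ (Ideal.jacobson (⊥ : Ideal S))) : ∃ n, a ^ n = 0 := by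
  obtain ⟨n, hn⟩ := apd_tnil hS (fun _ => a) (fun _ => ha)
  exact ⟨n, by simpa using hn⟩

/-- A surjection out of a module killed by `J` splits. -/
lemma apd_split (hS : IsPerfectRing S) {N N' : Type u} [AddCommGroup N] [Module S N] [AddCommGroup N'] [Module S N']
    (hN : ∀ a ∈ (Ideal.jacobson (⊥ : Ideal S)), ∀ n : N, a • n = 0) (q : N →ₗ[S] N') (hq : Function.Surjective q) :
    ∃ σ : N' →ₗ[S] N, q ∘ₗ σ = LinearMap.id := by
  obtain ⟨P, _, _, f, hP, hf, hK⟩ := hS N' inferInstance inferInstance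
  have hKJ := apd_superfluous _ hK
  obtain ⟨g, hg⟩ := Module.projective_lifting_property q f hq
  have hgJ : LinearMap.ker f ≤ LinearMap.ker g := by
    refine hKJ.trans (Submodule.smul_le.2 fun r hr n _ => ?_)
    rw [LinearMap.mem_ker, map_smul, hN r hr]
  refine ⟨(LinearMap.ker f).liftQ g hgJ ∘ₗ (f.quotKerEquivOfSurjective hf).symm.toLinearMap, ?_⟩
  ext n
  obtain ⟨p, rfl⟩ := hf n
  have : (f.quotKerEquivOfSurjective hf).symm (f p) = (LinearMap.ker f).mkQ p := by
    rw [LinearEquiv.symm_apply_eq]; rfl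
  simp only [LinearMap.comp_apply, LinearEquiv.coe_coe, this, LinearMap.id_apply]
  simpa using LinearMap.congr_fun hg p

lemma apd_semisimple (hS : IsPerfectRing S) {N : Type u} [AddCommGroup N] [Module S N]
    (hN : ∀ a ∈ (Ideal.jacobson (⊥ : Ideal S)), ∀ n : N, a • n = 0) : ComplementedLattice (Submodule S N) := by
  refine ⟨fun K => ?_⟩
  obtain ⟨σ, hσ⟩ := apd_split hS hN K.mkQ K.mkQ_surjective
  have h : ∀ n, K.mkQ (σ n) = n := fun n => LinearMap.congr_fun hσ n
  refine ⟨LinearMap.range σ, ?_, ?_⟩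
  · rw [Submodule.disjoint_def]
    rintro _ hx ⟨n, rfl⟩
    have := h n
    rw [Submodule.mkQ_apply, (Submodule.Quotient.mk_eq_zero K).2 hx] at this
    rw [← this, map_zero]
  · rw [codisjoint_iff, eq_top_iff]
    intro x _
    refine Submodule.mem_sup.2 ⟨x - σ (K.mkQ x), ?_, σ (K.mkQ x), ⟨_, rfl⟩, by abel⟩
    refine (Submodule.Quotient.mk_eq_zero K).1 ?_
    rw [← Submodule.mkQ_apply, map_sub, h, sub_self]

/-- An injection into a module killed by `J` splits. -/
lemma apd_retract (hS : IsPerfectRing S) {N N' : Type u} [AddCommGroup N] [Module S N] [AddCommGroup N'] [Module S N']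
    (hN : ∀ a ∈ (Ideal.jacobson (⊥ : Ideal S)), ∀ n : N, a • n = 0) (f : N' →ₗ[S] N) (hf : Function.Injective f) :
    ∃ g : N →ₗ[S] N', g ∘ₗ f = LinearMap.id := by
  have := apd_semisimple hS hN
  obtain ⟨K, hK⟩ := exists_isCompl (LinearMap.range f)
  refine ⟨(LinearEquiv.ofInjective f hf).symm.toLinearMap ∘ₗ
    (LinearMap.range f).projectionOnto K hK, ?_⟩
  ext x
  simp only [LinearMap.comp_apply, LinearEquiv.coe_coe, LinearMap.id_apply]
  rw [LinearEquiv.symm_apply_eq]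
  exact Submodule.projectionOnto_apply_left hK (LinearEquiv.ofInjective f hf x)

/-- The double annihilator of `J` is `J`. -/
lemma apd_socle (hS : IsPerfectRing S) {c : S} (hc : c ∉ (Ideal.jacobson (⊥ : Ideal S))) : ∃ a, (∀ j ∈ (Ideal.jacobson (⊥ : Ideal S)), a * j = 0) ∧ c * a ≠ 0 := by
  by_contra! hcon
  -- von Neumann regularity modulo `J`
  obtain ⟨d, hd⟩ : ∃ d, c - c * c * d ∈ (Ideal.jacobson (⊥ : Ideal S)) := by
    have hN : ∀ a ∈ (Ideal.jacobson (⊥ : Ideal S)), ∀ n : S ⧸ (Ideal.jacobson (⊥ : Ideal S)), a • n = 0 := by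
      intro a ha n
      obtain ⟨n, rfl⟩ := Submodule.mkQ_surjective _ n
      rw [← map_smul]
      exact (Submodule.Quotient.mk_eq_zero _).2 (Ideal.mul_mem_right _ _ ha)
    obtain ⟨K, hK⟩ := (apd_semisimple hS hN).exists_isCompl
      (Submodule.span S {Submodule.mkQ (Ideal.jacobson (⊥ : Ideal S)) c})
    have h1 : Submodule.mkQ (Ideal.jacobson (⊥ : Ideal S)) 1 ∈ Submodule.span S {Submodule.mkQ (Ideal.jacobson (⊥ : Ideal S)) c} ⊔ K := by
      rw [hK.sup_eq_top]; trivial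
    obtain ⟨y, hy, z, hz, hyz⟩ := Submodule.mem_sup.1 h1
    obtain ⟨d, rfl⟩ := Submodule.mem_span_singleton.1 hy
    refine ⟨d, ?_⟩
    have h2 : c • z = Submodule.mkQ (Ideal.jacobson (⊥ : Ideal S)) (c - c * c * d) := by
      rw [eq_sub_of_add_eq' hyz, ← map_smul, ← map_sub, ← map_smul]
      congr 1
      simp only [smul_eq_mul]
      ring
    have h3 : c • z = 0 := by
      refine Submodule.disjoint_def.1 hK.disjoint _ ?_ (K.smul_mem _ hz)
      rw [h2]
      refine Submodule.mem_span_singleton.2 ⟨1 - c * d, ?_⟩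
      rw [← map_smul]
      congr 1
      simp only [smul_eq_mul]
      ring
    rw [h2] at h3
    exact (Submodule.Quotient.mk_eq_zero _).1 h3
  obtain ⟨n, hn⟩ := apd_nil hS hd
  set u := (1 - c * d) ^ n with hu
  have hcu : c ^ n * u = 0 := by
    rw [hu, ← mul_pow, ← hn]; congr 1; ring
  obtain ⟨v, hv⟩ : ∃ v, 1 - u = c * v := by
    have := sub_dvd_pow_sub_pow (1 : S) (1 - c * d) n
    rw [one_pow] at this
    obtain ⟨w, hw⟩ := this
    exact ⟨d * w, by rw [hu, hw]; ring⟩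
  set e := (1 - u) ^ n with he
  have hev : e = c ^ n * v ^ n := by rw [he, hv, mul_pow]
  have heu : e * (1 - u) = e := by
    have : e * u = 0 := by rw [hev, mul_right_comm, hcu, zero_mul]
    rw [mul_sub, this]; ring
  have hpow : ∀ (x y : S), x * y = x → ∀ k, x * y ^ k = x := by
    intro x y h k
    induction k with
    | zero => simp
    | succ k ih => rw [pow_succ, ← mul_assoc, ih, h]
  have hee : e * e = e := hpow e (1 - u) heu n
  have hce : c ^ n * e = c ^ n := hpow _ _ (by rw [mul_sub, hcu]; ring) n
  have he0 : e * 1 ≠ 0 := by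
    intro h0
    rw [mul_one] at h0
    rw [h0, mul_zero] at hce
    apply hc
    exact Ideal.radical_le_jacobson ⟨n, by rw [← hce]; exact zero_mem _⟩
  have step : ∀ a : {a : S // e * a ≠ 0}, ∃ j ∈ (Ideal.jacobson (⊥ : Ideal S)), e * (a * j) ≠ 0 := by
    rintro ⟨a, ha⟩
    by_contra! h
    have h1 : c * (e * a) = 0 := hcon _ fun j hj => by rw [mul_assoc]; exact h j hj
    apply ha
    rcases n with _ | n
    · simp only [pow_zero] at he hn
      rw [← mul_one (e * a), hn, mul_zero]
    · calc e * a = e * (e * a) := by rw [← mul_assoc, hee]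
        _ = c ^ n * v ^ (n + 1) * (c * (e * a)) := by
            have h9 : e * (e * a) = c ^ (n + 1) * v ^ (n + 1) * (e * a) :=
              congrArg (fun z => z * (e * a)) hev
            rw [h9]
            ring
        _ = 0 := by rw [h1, mul_zero]
  choose j hj hj' using step
  let a : ℕ → {a : S // e * a ≠ 0} := fun k =>
    Nat.rec (motive := fun _ => {a : S // e * a ≠ 0}) ⟨1, he0⟩ (fun _ b => ⟨b * j b, hj' b⟩) k
  have ha : ∀ k, (a k).1 = ∏ i ∈ Finset.range k, j (a i) := by
    intro k
    induction k with
    | zero => simp [a]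
    | succ k ih => rw [Finset.prod_range_succ, ← ih]
  obtain ⟨k, hk⟩ := apd_tnil hS (fun i => j (a i)) (fun i => hj _)
  apply (a k).2
  rw [ha, hk, mul_zero]

/-- Injections between projective modules over a perfect ring split. -/
lemma apd_inj_split (hS : IsPerfectRing S) {P Q : Type u} [AddCommGroup P] [Module S P] [AddCommGroup Q] [Module S Q]
    [Module.Projective S P] [Module.Projective S Q] (f : P →ₗ[S] Q) (hf : Function.Injective f) :
    ∃ g : Q →ₗ[S] P, g ∘ₗ f = LinearMap.id := by
  have h1 : ∀ x, f x ∈ ((Ideal.jacobson (⊥ : Ideal S)) • ⊤ : Submodule S Q) → x ∈ ((Ideal.jacobson (⊥ : Ideal S)) • ⊤ : Submodule S P) := by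
    intro x hx
    refine apd_mem_of_dual _ _ fun φ => ?_
    by_contra hφ
    obtain ⟨a, haJ, ha⟩ := apd_socle hS hφ
    apply ha
    have h2 : a • f x = 0 := by
      refine Submodule.smul_induction_on hx ?_ ?_
      · intro r hr n _
        rw [smul_smul, haJ r hr, zero_smul]
      · intro y z hy hz
        rw [smul_add, hy, hz, add_zero]
    have h3 : a • x = 0 := hf (by rw [map_smul, h2, map_zero])
    rw [mul_comm, ← smul_eq_mul, ← map_smul, h3, map_zero]
  let PJ := ((Ideal.jacobson (⊥ : Ideal S)) • ⊤ : Submodule S P)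
  let QJ := ((Ideal.jacobson (⊥ : Ideal S)) • ⊤ : Submodule S Q)
  have hle : PJ ≤ QJ.comap f := by
    refine Submodule.smul_le.2 fun r hr n _ => ?_
    rw [Submodule.mem_comap, map_smul]
    exact Submodule.smul_mem_smul hr trivial
  have hinj : Function.Injective (PJ.mapQ QJ f hle) := by
    rw [← LinearMap.ker_eq_bot, eq_bot_iff]
    intro y hy
    obtain ⟨y, rfl⟩ := PJ.mkQ_surjective y
    refine (Submodule.mem_bot _).2 ((Submodule.Quotient.mk_eq_zero _).2 (h1 _ ?_))
    exact (Submodule.Quotient.mk_eq_zero QJ).1 hy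
  obtain ⟨g0, hg0⟩ := apd_retract hS (N := Q ⧸ QJ) (by
    intro a ha n
    obtain ⟨n, rfl⟩ := QJ.mkQ_surjective n
    rw [← map_smul]
    exact (Submodule.Quotient.mk_eq_zero _).2 (Submodule.smul_mem_smul ha trivial)) _ hinj
  obtain ⟨g, hg⟩ := Module.projective_lifting_property PJ.mkQ (g0 ∘ₗ QJ.mkQ) PJ.mkQ_surjective
  let h : P →ₗ[S] P := g ∘ₗ f
  have hh : ∀ x, h x - x ∈ PJ := by
    intro x
    rw [← Submodule.ker_mkQ PJ, LinearMap.mem_ker, map_sub, sub_eq_zero]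
    have e1 := LinearMap.congr_fun hg (f x)
    have e2 := LinearMap.congr_fun hg0 (PJ.mkQ x)
    exact e1.trans e2
  have hsurj : Function.Surjective h := by
    have hz : ∀ a : P ⧸ LinearMap.range h, a = 0 := by
      apply apd_nakayama hS
      rw [eq_top_iff]
      rintro a -
      obtain ⟨x, rfl⟩ := Submodule.mkQ_surjective _ a
      have h6 : (LinearMap.range h).mkQ x = (LinearMap.range h).mkQ (-(h x - x)) := by
        rw [neg_sub, map_sub, eq_comm, sub_eq_self]
        exact (Submodule.Quotient.mk_eq_zero _).2 ⟨x, rfl⟩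
      rw [h6]
      have h7 : Submodule.map (LinearMap.range h).mkQ PJ ≤ (Ideal.jacobson (⊥ : Ideal S)) • ⊤ := by
        rw [Submodule.map_smul'']
        exact Submodule.smul_mono le_rfl le_top
      exact h7 ⟨_, neg_mem (hh x), rfl⟩
    intro x
    exact (Submodule.Quotient.mk_eq_zero (LinearMap.range h)).1 (hz (Submodule.Quotient.mk x))
  obtain ⟨k, hk⟩ := Module.projective_lifting_property h LinearMap.id hsurj
  have hk' : ∀ x, h (k x) = x := fun x => LinearMap.congr_fun hk x
  have hker : LinearMap.ker h = ⊥ := by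
    apply apd_nakayama_sub hS
    intro x hx
    have hx0 : h x = 0 := hx
    have hxJ : x ∈ PJ := by
      have := hh x
      rw [hx0, zero_sub] at this
      simpa using this
    have h5 : Submodule.map (LinearMap.id - k ∘ₗ h) PJ ≤ (Ideal.jacobson (⊥ : Ideal S)) • LinearMap.ker h := by
      rw [Submodule.map_smul'']
      refine Submodule.smul_mono le_rfl ?_
      rintro _ ⟨y, -, rfl⟩
      simp [hk']
    exact h5 ⟨x, hxJ, by simp [hx0]⟩
  let E := LinearEquiv.ofBijective h ⟨LinearMap.ker_eq_bot.1 hker, hsurj⟩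
  refine ⟨E.symm.toLinearMap ∘ₗ g, ?_⟩
  ext x
  exact E.symm_apply_apply x

/-- A perfect ring has only finitely many maximal ideals. -/
lemma apd_finite_max (hS : IsPerfectRing S) : Finite (MaximalSpectrum S) := by
  have hN : ∀ a ∈ (Ideal.jacobson (⊥ : Ideal S)), ∀ n : S ⧸ (Ideal.jacobson (⊥ : Ideal S)), a • n = 0 := by
    intro a ha n
    obtain ⟨n, rfl⟩ := Submodule.mkQ_surjective _ n
    rw [← map_smul]
    exact (Submodule.Quotient.mk_eq_zero _).2 (Ideal.mul_mem_right _ _ ha)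
  have := apd_semisimple hS hN
  have h1 : IsSemisimpleModule S (S ⧸ (Ideal.jacobson (⊥ : Ideal S))) := { toComplementedLattice := this }
  have h2 : IsArtinian S (S ⧸ (Ideal.jacobson (⊥ : Ideal S))) := inferInstance
  have h3 : IsArtinianRing (S ⧸ (Ideal.jacobson (⊥ : Ideal S))) := isArtinian_of_tower S h2
  have h4 : Finite (MaximalSpectrum (S ⧸ (Ideal.jacobson (⊥ : Ideal S)))) := inferInstance
  let F : MaximalSpectrum (S ⧸ (Ideal.jacobson (⊥ : Ideal S))) → MaximalSpectrum S := fun m =>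
    ⟨m.1.comap (Ideal.Quotient.mk (Ideal.jacobson (⊥ : Ideal S))), by
      have := m.2
      exact Ideal.comap_isMaximal_of_surjective _ Ideal.Quotient.mk_surjective⟩
  refine Finite.of_surjective F fun m => ?_
  have hJm : (Ideal.jacobson (⊥ : Ideal S)) ≤ m.1 := sInf_le ⟨bot_le, m.2⟩
  have hcm : (m.1.map (Ideal.Quotient.mk (Ideal.jacobson (⊥ : Ideal S)))).comap (Ideal.Quotient.mk (Ideal.jacobson (⊥ : Ideal S))) = m.1 := by
    rw [Ideal.comap_map_of_surjective _ Ideal.Quotient.mk_surjective, ← RingHom.ker_eq_comap_bot,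
      Ideal.mk_ker, sup_eq_left.2 hJm]
  have hmax : (m.1.map (Ideal.Quotient.mk (Ideal.jacobson (⊥ : Ideal S)))).IsMaximal := by
    refine (Ideal.map_eq_top_or_isMaximal_of_surjective _ Ideal.Quotient.mk_surjective
      m.2).resolve_left fun h => m.2.ne_top ?_
    rw [← hcm, h, Ideal.comap_top]
  exact ⟨⟨_, hmax⟩, MaximalSpectrum.ext hcm⟩

end PerfectRing

section BackDirection

variable {R : Type u} [CommRing R]

lemma apd_tmul_zero {P : Type u} [AddCommGroup P] [Module R P] (r : R) (x : P)
    (h : (1 : R ⧸ Ideal.span {r}) ⊗ₜ[R] x = 0) : ∃ y, x = r • y := by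
  have := congrArg (TensorProduct.quotTensorEquivQuotSMul P (Ideal.span {r})) h
  rw [map_zero] at this
  have h2 : Submodule.Quotient.mk (p := (Ideal.span {r} • ⊤ : Submodule R P)) x = 0 := by
    rw [← this]
    exact (TensorProduct.quotTensorEquivQuotSMul_mk_tmul (M := P) (Ideal.span {r}) 1 x).symm ▸
      (by rw [one_smul])
  rw [Submodule.Quotient.mk_eq_zero, Submodule.ideal_span_singleton_smul] at h2
  obtain ⟨y, -, hy⟩ := h2
  exact ⟨y, hy.symm⟩

lemma apd_tmul_rep {P : Type u} [AddCommGroup P] [Module R P] (I : Ideal R)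
    (z : TensorProduct R (R ⧸ I) P) : ∃ x, z = (1 : R ⧸ I) ⊗ₜ[R] x := by
  induction z using TensorProduct.induction_on with
  | zero => exact ⟨0, by simp⟩
  | tmul a x =>
    obtain ⟨a, rfl⟩ := Ideal.Quotient.mk_surjective a
    refine ⟨a • x, ?_⟩
    rw [← TensorProduct.smul_tmul]
    congr 1
    rw [Algebra.smul_def, mul_one]; rfl
  | add a b ha hb =>
    obtain ⟨x, rfl⟩ := ha
    obtain ⟨y, rfl⟩ := hb
    exact ⟨x + y, by rw [TensorProduct.tmul_add]⟩

lemma apd_back [IsDomain R] (hR : IsAPD R) {P Q M : Type u} [AddCommGroup P] [Module R P]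
    [AddCommGroup Q] [Module R Q] [AddCommGroup M] [Module R M]
    [Module.Projective R P] [Module.Projective R Q] (f : P →ₗ[R] Q) (π : Q →ₗ[R] M)
    (hf : Function.Injective f) (hπ : Function.Surjective π)
    (hex : ∀ x, π x = 0 ↔ ∃ y, f y = x)
    (htf : ∀ (r : R) (m : M), r • m = 0 → r ≠ 0 → m = 0) : Module.Flat R M := by
  have key : ∀ (r : R), r ≠ 0 → ∃ g : TensorProduct R (R ⧸ Ideal.span {r}) Q →ₗ[R]
      TensorProduct R (R ⧸ Ideal.span {r}) P, ∀ x, g (1 ⊗ₜ f x) = 1 ⊗ₜ x := by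
    intro r hr
    have hS := hR (Ideal.span {r}) (by simpa using hr)
    let F := LinearMap.baseChange (R ⧸ Ideal.span {r}) f
    have hF : Function.Injective F := by
      rw [← LinearMap.ker_eq_bot, eq_bot_iff]
      intro z hz
      obtain ⟨x, rfl⟩ := apd_tmul_rep _ z
      have hz' : (1 : R ⧸ Ideal.span {r}) ⊗ₜ[R] f x = 0 := hz
      obtain ⟨y, hy⟩ := apd_tmul_zero r _ hz'
      have hy0 : π y = 0 := by
        refine htf r _ ?_ hr
        rw [← map_smul, ← hy]
        exact (hex _).2 ⟨x, rfl⟩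
      obtain ⟨p, rfl⟩ := (hex y).1 hy0
      have : x = r • p := hf (by rw [hy, map_smul])
      rw [this, ← TensorProduct.smul_tmul]
      have h0 : r • (1 : R ⧸ Ideal.span {r}) = 0 := by
        rw [Algebra.smul_def, mul_one]
        exact Ideal.Quotient.eq_zero_iff_mem.2 (Ideal.mem_span_singleton_self r)
      rw [h0, TensorProduct.zero_tmul]
      exact zero_mem _
    obtain ⟨g, hg⟩ := apd_inj_split hS F hF
    refine ⟨g.restrictScalars R, fun x => ?_⟩
    exact LinearMap.congr_fun hg (1 ⊗ₜ x)
  refine Module.Flat.of_forall_isTrivialRelation ?_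
  intro l c m hcm
  choose p hp using fun i => hπ (m i)
  obtain ⟨x, hx⟩ := (hex (∑ i, c i • p i)).1 (by rw [map_sum]; simpa [hp] using hcm)
  obtain ⟨y, hy⟩ : ∃ y : Fin l → P, x = ∑ i, c i • y i := by
    by_cases hc : ∀ i, c i = 0
    · refine ⟨0, hf ?_⟩
      rw [hx]
      simp [hc]
    · push Not at hc
      obtain ⟨i₀, hi₀⟩ := hc
      obtain ⟨g, hg⟩ := key (c i₀) hi₀
      choose y hy using fun i => apd_tmul_rep _ (g (1 ⊗ₜ p i))
      have h1 : (1 : R ⧸ Ideal.span {c i₀}) ⊗ₜ[R] (x - ∑ i, c i • y i) = 0 := by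
        rw [TensorProduct.tmul_sub, ← hg, hx, TensorProduct.tmul_sum, TensorProduct.tmul_sum,
          map_sum, sub_eq_zero]
        refine Finset.sum_congr rfl fun i _ => ?_
        rw [TensorProduct.tmul_smul, TensorProduct.tmul_smul, map_smul, hy]
      obtain ⟨w, hw⟩ := apd_tmul_zero _ _ h1
      refine ⟨fun i => y i + Pi.single (M := fun _ => P) i₀ w i, ?_⟩
      have h2 : ∑ i, c i • Pi.single (M := fun _ => P) i₀ w i = c i₀ • w := by
        rw [Finset.sum_eq_single i₀]
        · simp
        · intro b _ hb; simp [hb]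
        · simp
      simp only [smul_add, Finset.sum_add_distrib]
      rw [h2, ← hw]; abel
  have h3 : ∑ i, c i • (p i - f (y i)) = 0 := by
    simp only [smul_sub, Finset.sum_sub_distrib]
    rw [← hx, hy, map_sum]
    simp
  obtain ⟨k, a, z, h4, h5⟩ := Module.Flat.isTrivialRelation_of_sum_smul_eq_zero h3
  refine ⟨k, a, fun j => π (z j), fun i => ?_, h5⟩
  have h4i : p i - f (y i) = ∑ j, a i j • z j := h4 i
  have := congrArg π h4i
  rw [map_sub, (hex _).2 ⟨y i, rfl⟩, sub_zero, hp] at this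
  rw [this, map_sum]
  simp

lemma apd_back' [IsDomain R] (hR : IsAPD R) {M : Type u} [AddCommGroup M] [Module R M]
    (htf : ∀ (r : R) (m : M), r • m = 0 → r ≠ 0 → m = 0)
    (h : ProjDimLE R 1 (ModuleCat.of R M)) : Module.Flat R M := by
  obtain ⟨P, f, hf, hP, hK⟩ := h
  have hK' : Projective (kernel f) := hK
  have h1 : Module.Projective R P := (IsProjective.iff_projective (R := R) P).2 hP
  have h2 : Module.Projective R (LinearMap.ker f.hom) :=
    (IsProjective.iff_projective (R := R) _).2 (Projective.of_iso (ModuleCat.kernelIsoKer f) hK')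
  refine apd_back hR (LinearMap.ker f.hom).subtype f.hom (Submodule.injective_subtype _)
    ((ModuleCat.epi_iff_surjective f).1 hf) (fun x => ?_) htf
  constructor
  · intro hx; exact ⟨⟨x, hx⟩, rfl⟩
  · rintro ⟨y, rfl⟩; exact y.2

end BackDirection

section Homological

variable {R : Type u} [CommRing R]

/-- Projective dimension `< n`. -/
abbrev ApdPD (R : Type u) [CommRing R] (n : ℕ) (X : Type u) [AddCommGroup X] [Module R X] : Prop :=
  HasProjectiveDimensionLT (ModuleCat.of R X) n

variable {X Y Z : Type u} [AddCommGroup X] [Module R X] [AddCommGroup Y] [Module R Y]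
  [AddCommGroup Z] [Module R Z]

lemma apd_ses (f : X →ₗ[R] Y) (g : Y →ₗ[R] Z) (hf : Function.Injective f)
    (hg : Function.Surjective g) (h : Function.Exact f g) :
    (ShortComplex.mk (ModuleCat.ofHom f) (ModuleCat.ofHom g)
      (by ext x; exact (h (f x)).2 ⟨x, rfl⟩)).ShortExact :=
  { exact := (ShortComplex.ShortExact.moduleCat_exact_iff_function_exact _).2 h
    mono_f := (ModuleCat.mono_iff_injective _).2 hf
    epi_g := (ModuleCat.epi_iff_surjective _).2 hg }

lemma apd_pd_retract (n : ℕ) (i : X →ₗ[R] Y) (r : Y →ₗ[R] X) (h : ∀ x, r (i x) = x)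
    (hY : ApdPD R n Y) : ApdPD R n X :=
  Retract.hasProjectiveDimensionLT (X := ModuleCat.of R X) (Y := ModuleCat.of R Y)
    { i := ModuleCat.ofHom i
      r := ModuleCat.ofHom r
      retract := by ext x; exact h x } n

lemma apd_pd_equiv (n : ℕ) (e : X ≃ₗ[R] Y) (hY : ApdPD R n Y) : ApdPD R n X :=
  apd_pd_retract n e.toLinearMap e.symm.toLinearMap (by simp) hY

lemma apd_pd_proj (h : Module.Projective R X) : ApdPD R 1 X :=
  projective_iff_hasProjectiveDimensionLT_one.1 ((IsProjective.iff_projective (R := R) X).1 h)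

lemma apd_proj_pd (h : ApdPD R 1 X) : Module.Projective R X :=
  (IsProjective.iff_projective (R := R) X).2 (projective_iff_hasProjectiveDimensionLT_one.2 h)

lemma apd_pd_sum_step {ι : Type u} [DecidableEq ι] (n : ℕ) {K P A : ι → Type u}
    [∀ i, AddCommGroup (K i)] [∀ i, Module R (K i)] [∀ i, AddCommGroup (P i)]
    [∀ i, Module R (P i)] [∀ i, AddCommGroup (A i)] [∀ i, Module R (A i)]
    (k : ∀ i, K i →ₗ[R] P i) (f : ∀ i, P i →ₗ[R] A i) (hk : ∀ i, Function.Injective (k i))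
    (hf : ∀ i, Function.Surjective (f i)) (hex : ∀ i, Function.Exact (k i) (f i))
    [∀ i, Module.Projective R (P i)] (hKs : ApdPD R (n + 1) (Π₀ i, K i)) :
    ApdPD R (n + 2) (Π₀ i, A i) := by
  classical
  have hP : ApdPD R 1 (Π₀ i, P i) := apd_pd_proj inferInstance
  refine (apd_ses (X := Π₀ i, K i) (Y := Π₀ i, P i) (Z := Π₀ i, A i)
    (DFinsupp.mapRange.linearMap k)
    (DFinsupp.mapRange.linearMap f) ?_ ?_ ?_).hasProjectiveDimensionLT_X₃ (n + 1) hKs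
    (hasProjectiveDimensionLT_of_ge _ 1 (n + 1 + 1) (by omega))
  · exact (DFinsupp.mapRange_injective _ fun _ => map_zero _).2 hk
  · exact (DFinsupp.mapRange_surjective _ fun _ => map_zero _).2 hf
  · intro y
    constructor
    · intro hy
      have hy' : ∀ i, ∃ x, k i x = y i := fun i => by
        have := DFunLike.congr_fun hy i
        exact (hex i _).1 (by simpa using this)
      choose x hx using hy'
      refine ⟨DFinsupp.mk y.support fun i => x i, ?_⟩
      ext1 i
      simp only [DFinsupp.mapRange.linearMap_apply, DFinsupp.mapRange_apply, DFinsupp.mk_apply]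
      split_ifs with hi
      · exact hx i
      · simpa using (DFinsupp.notMem_support_iff.1 hi).symm
    · rintro ⟨x, rfl⟩
      ext1 i
      simpa using (hex i _).2 ⟨x i, rfl⟩

lemma apd_pd_sum {ι : Type u} [DecidableEq ι] (n : ℕ) (A : ι → Type u) [∀ i, AddCommGroup (A i)]
    [∀ i, Module R (A i)] (h : ∀ i, ApdPD R (n + 1) (A i)) :
    ApdPD R (n + 1) (Π₀ i, A i) := by
  induction n generalizing A with
  | zero =>
    have : ∀ i, Module.Projective R (A i) := fun i => apd_proj_pd (h i)
    exact apd_pd_proj inferInstance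
  | succ n ih =>
    let f : ∀ i, (A i →₀ R) →ₗ[R] A i := fun i => Finsupp.linearCombination R id
    have hf : ∀ i, Function.Surjective (f i) := fun i => Finsupp.linearCombination_id_surjective R _
    have hK : ∀ i, ApdPD R (n + 1) (LinearMap.ker (f i)) := fun i =>
      (apd_ses (LinearMap.ker (f i)).subtype (f i) (Submodule.injective_subtype _) (hf i)
        (LinearMap.exact_subtype_ker_map _)).hasProjectiveDimensionLT_X₁ (n + 1)
        (by
          have := apd_pd_proj (R := R) (X := (A i →₀ R)) inferInstance
          exact hasProjectiveDimensionLT_of_ge _ 1 (n + 1) (by omega)) (h i)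
    have hKs := ih (fun i => LinearMap.ker (f i)) hK
    exact apd_pd_sum_step n (K := fun i => LinearMap.ker (f i)) (P := fun i => (A i →₀ R))
      (fun i => (LinearMap.ker (f i)).subtype) f
      (fun i => Submodule.injective_subtype _) hf (fun i => LinearMap.exact_subtype_ker_map _) hKs

/-- The telescope. -/
lemma apd_telescope (n : ℕ) (A : ℕ → Submodule R X) (hA : Monotone A) (hU : ∀ x, ∃ k, x ∈ A k)
    (h : ∀ k, ApdPD R (n + 1) (A k)) : ApdPD R (n + 2) X := by
  have hD : ApdPD R (n + 1) (Π₀ k : ULift.{u} ℕ, A k.down) := apd_pd_sum n _ fun k => h k.down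
  let e : ∀ k : ULift.{u} ℕ, A k.down →ₗ[R] (Π₀ k : ULift.{u} ℕ, A k.down) := fun k =>
    DFinsupp.lsingle (M := fun k : ULift.{u} ℕ => A k.down) k
  let up : ∀ k : ULift.{u} ℕ, A k.down →ₗ[R] A (k.down + 1) := fun k =>
    Submodule.inclusion (hA (Nat.le_succ _))
  let φ : (Π₀ k : ULift.{u} ℕ, A k.down) →ₗ[R] (Π₀ k : ULift.{u} ℕ, A k.down) :=
    DFinsupp.lsum ℕ fun k => e k - e ⟨k.down + 1⟩ ∘ₗ up k
  let ψ : (Π₀ k : ULift.{u} ℕ, A k.down) →ₗ[R] X :=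
    DFinsupp.lsum ℕ fun k => (A k.down).subtype
  have hφ : ∀ k a, φ (e k a) = e k a - e ⟨k.down + 1⟩ (up k a) := fun k a => by
    simp only [φ, e, DFinsupp.lsingle_apply, DFinsupp.lsum_single]; rfl
  have hψ : ∀ k a, ψ (e k a) = a := fun k a => by
    simp only [ψ, e, DFinsupp.lsingle_apply, DFinsupp.lsum_single]; rfl
  let σ : ℕ → (Π₀ k : ULift.{u} ℕ, A k.down) →ₗ[R] X := fun m =>
    DFinsupp.lsum ℕ fun k => if k.down ≤ m then (A k.down).subtype else 0
  have hσ : ∀ m k a, σ m (e k a) = if k.down ≤ m then (a : X) else 0 := fun m k a => by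
    simp only [σ, e, DFinsupp.lsingle_apply, DFinsupp.lsum_single]
    split_ifs <;> rfl
  have hσφ : ∀ m x, σ m (φ x) = (x ⟨m⟩ : X) := by
    intro m x
    induction x using DFinsupp.induction with
    | h0 => simp
    | ha k a x _ _ ih =>
      have hka : DFinsupp.single k a = e k a := rfl
      rw [map_add, map_add, ih, hka, hφ, map_sub, hσ, hσ, DFinsupp.add_apply, Submodule.coe_add]
      congr 1
      rcases lt_trichotomy k.down m with hk | hk | hk
      · have : k ≠ ⟨m⟩ := by rintro rfl; simp at hk
        rw [if_pos hk.le, if_pos (by exact hk)]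
        simp only [e, DFinsupp.lsingle_apply, DFinsupp.single_eq_of_ne this.symm]
        simp [up]
      · obtain ⟨k⟩ := k
        simp only at hk
        subst hk
        simp [e]
      · have : k ≠ ⟨m⟩ := by rintro rfl; simp at hk
        rw [if_neg (by omega), if_neg (by simp; omega)]
        simp [e, DFinsupp.single_eq_of_ne this.symm]
  have hmove : ∀ (k : ℕ) (x : X) (hx : x ∈ A k) (m : ℕ) (hm : k ≤ m),
      e ⟨k⟩ ⟨x, hx⟩ - e ⟨m⟩ ⟨x, hA hm hx⟩ ∈ LinearMap.range φ := by
    intro k x hx m hm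
    induction m, hm using Nat.le_induction with
    | base => rw [sub_self]; exact zero_mem _
    | succ m hm ih =>
      have h1 : e ⟨m⟩ ⟨x, hA hm hx⟩ - e ⟨m + 1⟩ ⟨x, hA (hm.trans (Nat.le_succ m)) hx⟩ ∈
          LinearMap.range φ := ⟨e ⟨m⟩ ⟨x, hA hm hx⟩, hφ _ _⟩
      have := add_mem ih h1
      rwa [sub_add_sub_cancel] at this
  have hker : ∀ y, ∃ m₀, ∀ m, m₀ ≤ m → ∃ hm : ψ y ∈ A m,
      y - e ⟨m⟩ ⟨ψ y, hm⟩ ∈ LinearMap.range φ := by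
    intro y
    induction y using DFinsupp.induction with
    | h0 =>
      refine ⟨0, fun m _ => ⟨by simp, ?_⟩⟩
      have : (⟨ψ 0, by simp⟩ : A m) = 0 := by ext; simp
      rw [this]; simp
    | ha k a x _ _ ih =>
      obtain ⟨m₀, hm₀⟩ := ih
      refine ⟨max m₀ k.down, fun m hm => ?_⟩
      obtain ⟨h1, h2⟩ := hm₀ m (le_trans (le_max_left _ _) hm)
      have h3 : k.down ≤ m := le_trans (le_max_right _ _) hm
      have h4 := hmove k.down a a.2 m h3
      have h5 : ψ (DFinsupp.single k a + x) = a + ψ x := by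
        rw [map_add]; congr 1; exact hψ k a
      refine ⟨by rw [h5]; exact add_mem (hA h3 a.2) h1, ?_⟩
      have h6 : (⟨ψ (DFinsupp.single k a + x), by rw [h5]; exact add_mem (hA h3 a.2) h1⟩ : A m) =
        ⟨a, hA h3 a.2⟩ + ⟨ψ x, h1⟩ := Subtype.ext h5
      rw [h6, map_add]
      have := add_mem h4 h2
      rw [sub_add_sub_comm] at this
      exact this
  refine (apd_ses φ ψ ?_ ?_ ?_).hasProjectiveDimensionLT_X₃ (n + 1) hD
    (hasProjectiveDimensionLT_of_ge _ (n + 1) (n + 1 + 1) (by omega))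
  · rw [← LinearMap.ker_eq_bot, eq_bot_iff]
    intro x hx
    rw [Submodule.mem_bot]
    ext k
    rw [← hσφ k.down x, LinearMap.mem_ker.1 hx]
    simp
  · intro x
    obtain ⟨k, hk⟩ := hU x
    exact ⟨e ⟨k⟩ ⟨x, hk⟩, hψ _ _⟩
  · intro y
    constructor
    · intro hy
      obtain ⟨m, hm⟩ := hker y
      obtain ⟨h1, h2⟩ := hm m le_rfl
      have h3 : (⟨ψ y, h1⟩ : A m) = 0 := Subtype.ext hy
      rw [h3, map_zero, sub_zero] at h2
      exact h2
    · rintro ⟨x, rfl⟩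
      induction x using DFinsupp.induction with
      | h0 => simp
      | ha k a x _ _ ih =>
        have hka : DFinsupp.single k a = e k a := rfl
        rw [map_add, map_add, ih, hka, hφ, map_sub, hψ, hψ]
        simp [up]

lemma apd_telescope' (n : ℕ) (A : ℕ → Submodule R X) (U : Submodule R X) (hA : Monotone A)
    (hU : ∀ x, x ∈ U ↔ ∃ k, x ∈ A k)
    (h : ∀ k, ApdPD R (n + 1) (A k)) : ApdPD R (n + 2) U := by
  refine apd_telescope n (fun k => (A k).comap U.subtype) (fun i j hij => ?_) (fun x => ?_)
    fun k => ?_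
  · exact Submodule.comap_mono (hA hij)
  · exact (hU x).1 x.2
  · exact apd_pd_equiv _ (Submodule.comapSubtypeEquivOfLe fun x hx => (hU x).2 ⟨k, hx⟩) (h k)

lemma apd_pd_final (h : ApdPD R 2 X) : ProjDimLE R 1 (ModuleCat.of R X) := by
  let f : (X →₀ R) →ₗ[R] X := Finsupp.linearCombination R id
  have hf : Function.Surjective f := Finsupp.linearCombination_id_surjective R _
  have hP := apd_pd_proj (R := R) (X := (X →₀ R)) inferInstance
  refine ⟨ModuleCat.of R (X →₀ R), ModuleCat.ofHom f, (ModuleCat.epi_iff_surjective _).2 hf,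
    (IsProjective.iff_projective (R := R) _).1 inferInstance, ?_⟩
  have hK : ApdPD R 1 (LinearMap.ker f) :=
      (apd_ses (LinearMap.ker f).subtype f (Submodule.injective_subtype _) hf
        (LinearMap.exact_subtype_ker_map _)).hasProjectiveDimensionLT_X₁ 1 hP h
  have := projective_iff_hasProjectiveDimensionLT_one.2 hK
  exact Projective.of_iso (ModuleCat.kernelIsoKer (ModuleCat.ofHom f)).symm this

end Homological

section TorsionDecomposition

variable {R : Type u} [CommRing R] [IsDomain R]

lemma apd_max_finite (hR : IsAPD R) (I : Ideal R) (hI : I ≠ ⊥) :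
    {m : MaximalSpectrum R | I ≤ m.asIdeal}.Finite := by
  have := apd_finite_max (hR I hI)
  have hmax : ∀ m : {m : MaximalSpectrum R | I ≤ m.asIdeal},
      (m.1.asIdeal.map (Ideal.Quotient.mk I)).IsMaximal := fun m =>
    haveI := m.1.isMaximal
    Ideal.IsMaximal.map_of_surjective_of_ker_le Ideal.Quotient.mk_surjective
      (by rw [Ideal.mk_ker]; exact m.2)
  let F : {m : MaximalSpectrum R | I ≤ m.asIdeal} → MaximalSpectrum (R ⧸ I) := fun m =>
    ⟨_, hmax m⟩
  have hF : Function.Injective F := by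
    intro m m' h
    have h1 : m.1.asIdeal.map (Ideal.Quotient.mk I) = m'.1.asIdeal.map (Ideal.Quotient.mk I) :=
      congrArg MaximalSpectrum.asIdeal h
    have h2 := congrArg (Ideal.comap (Ideal.Quotient.mk I)) h1
    rw [Ideal.comap_map_of_surjective' _ Ideal.Quotient.mk_surjective,
      Ideal.comap_map_of_surjective' _ Ideal.Quotient.mk_surjective, Ideal.mk_ker,
      sup_eq_left.2 (show I ≤ m.1.asIdeal from m.2),
      sup_eq_left.2 (show I ≤ m'.1.asIdeal from m'.2)] at h2
    exact Subtype.ext (MaximalSpectrum.ext h2)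
  exact Set.finite_coe_iff.1 (Finite.of_injective F hF)

lemma apd_pow_mem (hR : IsAPD R) (I : Ideal R) (hI : I ≠ ⊥) (y : R)
    (hy : ∀ m : MaximalSpectrum R, I ≤ m.asIdeal → y ∈ m.asIdeal) : ∃ n, y ^ n ∈ I := by
  have hJ : Ideal.Quotient.mk I y ∈ Ideal.jacobson (⊥ : Ideal (R ⧸ I)) := by
    rw [Ideal.jacobson, Submodule.mem_sInf]
    rintro m ⟨-, hm⟩
    have h1 : (Ideal.comap (Ideal.Quotient.mk I) m).IsMaximal :=
      Ideal.comap_isMaximal_of_surjective _ Ideal.Quotient.mk_surjective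
    refine hy ⟨_, h1⟩ ?_
    intro x hx
    show Ideal.Quotient.mk I x ∈ m
    rw [Ideal.Quotient.eq_zero_iff_mem.2 hx]
    exact zero_mem _
  obtain ⟨n, hn⟩ := apd_nil (hR I hI) hJ
  exact ⟨n, Ideal.Quotient.eq_zero_iff_mem.1 (by rw [map_pow, hn])⟩

variable (T : Type u) [AddCommGroup T] [Module R T]

/-- Elements killed by something outside `m`. -/
def apdL (m : MaximalSpectrum R) : Submodule R T where
  carrier := {x | ∃ a ∉ m.asIdeal, a • x = 0}
  zero_mem' := ⟨1, fun h => m.isMaximal.ne_top ((Ideal.eq_top_iff_one _).2 h), by simp⟩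
  add_mem' := by
    rintro x y ⟨a, ha, hx⟩ ⟨b, hb, hy⟩
    refine ⟨a * b, fun h => (m.isMaximal.isPrime.mem_or_mem h).elim ha hb, ?_⟩
    rw [smul_add, mul_comm, mul_smul, hx, mul_comm, mul_smul, hy]
    simp
  smul_mem' := by
    rintro c x ⟨a, ha, hx⟩
    exact ⟨a, ha, by rw [smul_comm, hx, smul_zero]⟩

/-- The local component at `m`. -/
def apdT (m : MaximalSpectrum R) : Submodule R T :=
  ⨅ m' : MaximalSpectrum R, ⨅ _ : m' ≠ m, apdL T m'

/-- Elements killed by a power of `s`. -/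
def apdTor (s : R) : Submodule R T where
  carrier := {x | ∃ n : ℕ, s ^ n • x = 0}
  zero_mem' := ⟨0, by simp⟩
  add_mem' := by
    rintro x y ⟨a, hx⟩ ⟨b, hy⟩
    refine ⟨a + b, ?_⟩
    rw [smul_add, pow_add, mul_comm, mul_smul, hx, mul_comm, mul_smul, hy]
    simp
  smul_mem' := by
    rintro c x ⟨a, hx⟩
    exact ⟨a, by rw [smul_comm, hx, smul_zero]⟩

variable {T}

lemma apd_mem_T {m : MaximalSpectrum R} {x : T} :
    x ∈ apdT T m ↔ ∀ m' : MaximalSpectrum R, m' ≠ m → x ∈ apdL T m' := by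
  simp [apdT, Submodule.mem_iInf]

/-- An ideal in no maximal ideal. -/
lemma apd_one_mem (I : Ideal R) (h : ∀ m : MaximalSpectrum R, ∃ a ∈ I, a ∉ m.asIdeal) :
    (1 : R) ∈ I := by
  by_contra hI
  obtain ⟨m, hm, hle⟩ := Ideal.exists_le_maximal I (fun h => hI (h ▸ Submodule.mem_top))
  obtain ⟨a, ha, ha'⟩ := h ⟨m, hm⟩
  exact ha' (hle ha)

lemma apd_disj (m : MaximalSpectrum R) : Disjoint (apdT T m) (apdL T m) := by
  rw [Submodule.disjoint_def]
  intro x hx hx'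
  rw [apd_mem_T] at hx
  have := apd_one_mem (LinearMap.ker (LinearMap.toSpanSingleton R T x)) (fun m' => by
    have : x ∈ apdL T m' := by
      by_cases h : m' = m
      · exact h ▸ hx'
      · exact hx m' h
    obtain ⟨a, ha, hax⟩ := this
    exact ⟨a, by simpa using hax, ha⟩)
  simpa using this

lemma apd_codisj (hR : IsAPD R) (hT : ∀ x : T, ∃ r : R, r ≠ 0 ∧ r • x = 0)
    (m : MaximalSpectrum R) (x : T) : ∃ y ∈ apdT T m, ∃ z ∈ apdL T m, y + z = x := by
  classical
  obtain ⟨r, hr, hrx⟩ := hT x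
  have hI : Ideal.span {r} ≠ ⊥ := by simpa using hr
  have hfin := apd_max_finite hR _ hI
  let F := hfin.toFinset.filter (· ≠ m)
  have hF : ∀ m', m' ∈ F ↔ r ∈ m'.asIdeal ∧ m' ≠ m := fun m' => by
    simp [F, Ideal.span_le]
  have htop : m.asIdeal ⊔ ⨅ m' ∈ F, m'.asIdeal = ⊤ := by
    refine Ideal.sup_iInf_eq_top fun m' hm' => ?_
    exact Ideal.IsMaximal.coprime_of_ne m.isMaximal m'.isMaximal
      (fun h => ((hF m').1 hm').2 (MaximalSpectrum.ext h.symm))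
  obtain ⟨u, hu, v, hv, huv⟩ := Submodule.mem_sup.1 ((Ideal.eq_top_iff_one _).1 htop)
  have hv' : ∀ m' : MaximalSpectrum R, r ∈ m'.asIdeal → m' ≠ m → v ∈ m'.asIdeal := by
    intro m' h1 h2
    simp only [Submodule.mem_iInf] at hv
    exact hv m' ((hF m').2 ⟨h1, h2⟩)
  obtain ⟨n, hn⟩ := apd_pow_mem hR _ hI (u * v) (fun m' hm' => by
    have hr' : r ∈ m'.asIdeal := hm' (Ideal.mem_span_singleton_self r)
    by_cases h : m' = m
    · exact Ideal.mul_mem_right _ _ (h ▸ hu)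
    · exact Ideal.mul_mem_left _ _ (hv' m' hr' h))
  obtain ⟨c, hc⟩ := Ideal.mem_span_singleton'.1 hn
  have hzero : (u * v) ^ n • x = 0 := by rw [← hc, mul_smul, hrx, smul_zero]
  obtain ⟨α, β, hαβ⟩ := (IsCoprime.pow (m := n) (n := n) (show IsCoprime u v from
    ⟨1, 1, by simpa using huv⟩))
  have hone : ∀ m' : MaximalSpectrum R, ∀ a b : R, a + b = 1 → a ∈ m'.asIdeal →
      b ^ n ∉ m'.asIdeal := by
    intro m' a b hab ha hb
    have hb' := m'.isMaximal.isPrime.mem_of_pow_mem n hb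
    exact m'.isMaximal.ne_top ((Ideal.eq_top_iff_one _).2 (hab ▸ add_mem ha hb'))
  refine ⟨(β * v ^ n) • x, ?_, (α * u ^ n) • x, ?_, ?_⟩
  · rw [apd_mem_T]
    intro m' hm'
    by_cases h : r ∈ m'.asIdeal
    · refine ⟨u ^ n, hone m' v u (by rw [add_comm, huv]) (hv' m' h hm'), ?_⟩
      rw [smul_smul, show u ^ n * (β * v ^ n) = β * (u * v) ^ n by ring, mul_smul, hzero, smul_zero]
    · exact ⟨r, h, by rw [smul_comm, hrx, smul_zero]⟩
  · refine ⟨v ^ n, hone m u v huv hu, ?_⟩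
    rw [smul_smul, show v ^ n * (α * u ^ n) = α * (u * v) ^ n by ring, mul_smul, hzero, smul_zero]
  · rw [← add_smul, add_comm, hαβ, one_smul]

lemma apd_isCompl (hR : IsAPD R) (hT : ∀ x : T, ∃ r : R, r ≠ 0 ∧ r • x = 0)
    (m : MaximalSpectrum R) : IsCompl (apdT T m) (apdL T m) :=
  ⟨apd_disj m, codisjoint_iff.2 (eq_top_iff.2 fun x _ =>
    Submodule.mem_sup.2 (apd_codisj hR hT m x))⟩

lemma apd_internal (hR : IsAPD R) (hT : ∀ x : T, ∃ r : R, r ≠ 0 ∧ r • x = 0)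
    [DecidableEq (MaximalSpectrum R)] :
    DirectSum.IsInternal (fun m : MaximalSpectrum R => apdT T m) := by
  refine DirectSum.isInternal_submodule_of_iSupIndep_of_iSup_eq_top ?_ ?_
  · intro m
    refine (apd_disj m).mono_right ?_
    refine iSup₂_le fun m' hm' => ?_
    intro x hx
    exact apd_mem_T.1 hx m hm'.symm
  · rw [eq_top_iff]
    intro x _
    have := apd_one_mem ((⨆ m : MaximalSpectrum R, apdT T m).comap
      (LinearMap.toSpanSingleton R T x)) (fun m => by
      obtain ⟨y, hy, z, ⟨a, ha, haz⟩, rfl⟩ := apd_codisj hR hT m x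
      refine ⟨a, ?_, ha⟩
      simp only [Submodule.mem_comap, LinearMap.toSpanSingleton_apply, smul_add, haz, add_zero]
      exact Submodule.smul_mem _ _ (Submodule.mem_iSup_of_mem m hy))
    simpa using this

lemma apd_T_le (hR : IsAPD R) (hT : ∀ x : T, ∃ r : R, r ≠ 0 ∧ r • x = 0)
    (m : MaximalSpectrum R) (s : R) (hs : s ∈ m.asIdeal) : apdT T m ≤ apdTor T s := by
  intro x hx
  obtain ⟨r, hr, hrx⟩ := hT x
  obtain ⟨n, hn⟩ := apd_pow_mem hR (LinearMap.ker (LinearMap.toSpanSingleton R T x))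
    (fun h => hr (by
      have : r ∈ LinearMap.ker (LinearMap.toSpanSingleton R T x) := by simpa using hrx
      rw [h] at this
      simpa using this)) s (fun m' hm' => by
    by_cases h : m' = m
    · exact h ▸ hs
    · obtain ⟨a, ha, hax⟩ := apd_mem_T.1 hx m' h
      exact absurd (hm' (show a ∈ LinearMap.ker (LinearMap.toSpanSingleton R T x) by
        simpa using hax)) ha)
  exact ⟨n, by simpa using hn⟩

lemma apd_pd_torsion (hR : IsAPD R) (hQ : ¬ IsField R)
    (hT : ∀ x : T, ∃ r : R, r ≠ 0 ∧ r • x = 0) (d : ℕ)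
    (h : ∀ s : R, s ≠ 0 → ApdPD R (d + 1) (apdTor T s)) : ApdPD R (d + 1) T := by
  classical
  have e : (DirectSum (MaximalSpectrum R) fun m => apdT T m) ≃ₗ[R] T :=
    LinearEquiv.ofBijective (DirectSum.coeLinearMap _) (apd_internal hR hT)
  refine apd_pd_equiv _ e.symm ?_
  refine apd_pd_sum d (fun m : MaximalSpectrum R => apdT T m) fun m => ?_
  have hm : m.asIdeal ≠ ⊥ := Ring.ne_bot_of_isMaximal_of_not_isField m.isMaximal hQ
  obtain ⟨s, hs, hs0⟩ := Submodule.exists_mem_ne_zero_of_ne_bot hm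
  refine apd_pd_retract _ (Submodule.inclusion (apd_T_le hR hT m s hs))
    ((Submodule.projectionOnto _ _ (apd_isCompl hR hT m)) ∘ₗ (apdTor T s).subtype) ?_ (h s hs0)
  intro x
  simp [Submodule.projectionOnto_apply_left]

end TorsionDecomposition

section Forward

variable {R : Type u} [CommRing R] [IsDomain R]

lemma apd_pd_finsupp (B X : Type u) [AddCommGroup X] [Module R X] (n : ℕ)
    (h : ApdPD R (n + 1) X) : ApdPD R (n + 1) (B →₀ X) := by
  classical
  exact apd_pd_equiv _ (finsuppLequivDFinsupp R) (apd_pd_sum n (fun _ : B => X) fun _ => h)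

lemma apd_pd_quot (r : R) (hr : r ≠ 0) : ApdPD R 2 (R ⧸ Ideal.span {r}) := by
  have hP : ApdPD R 1 R := apd_pd_proj inferInstance
  refine (apd_ses (LinearMap.mulRight R r) (Submodule.mkQ (Ideal.span {r})) ?_
    (Submodule.mkQ_surjective _) ?_).hasProjectiveDimensionLT_X₃ 1 hP
    (hasProjectiveDimensionLT_of_ge _ 1 2 (by omega))
  · intro a b h
    exact mul_right_cancel₀ hr h
  · intro y
    rw [Submodule.mkQ_apply, Submodule.Quotient.mk_eq_zero, Ideal.mem_span_singleton']
    rfl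

lemma apd_pd_projquot (r : R) (hr : r ≠ 0) (P : Type u) [AddCommGroup P] [Module R P]
    [Module (R ⧸ Ideal.span {r}) P] [IsScalarTower R (R ⧸ Ideal.span {r}) P]
    (hP : Module.Projective (R ⧸ Ideal.span {r}) P) : ApdPD R 2 P := by
  obtain ⟨σ, hσ⟩ := Module.projective_def'.1 hP
  refine apd_pd_retract 2 (Y := P →₀ (R ⧸ Ideal.span {r})) (σ.restrictScalars R)
    ((Finsupp.linearCombination (R ⧸ Ideal.span {r}) id).restrictScalars R) ?_
    (apd_pd_finsupp _ _ 1 (apd_pd_quot r hr))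
  intro x
  exact LinearMap.congr_fun hσ x

lemma apd_pd_flatquot (hR : IsAPD R) (r : R) (hr : r ≠ 0) (N : Type u) [AddCommGroup N]
    [Module R N] [Module.Flat R N] :
    ApdPD R 2 (N ⧸ (Ideal.span {r} • (⊤ : Submodule R N))) := by
  have hS := hR (Ideal.span {r}) (by simpa using hr)
  have := apd_flat_projective hS (TensorProduct R (R ⧸ Ideal.span {r}) N)
  exact apd_pd_equiv 2 (TensorProduct.quotTensorEquivQuotSMul N (Ideal.span {r})).symm
    (apd_pd_projquot r hr _ this)

variable {V : Type u} [AddCommGroup V] [Module R V]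

/-- The elements of `V` pushed into `N` by `s ^ n`. -/
def apdW (N : Submodule R V) (s : R) : Submodule R V :=
  N.comap (LinearMap.lsmul R V s)

lemma apd_mem_W {N : Submodule R V} {s : R} {v : V} : v ∈ apdW N s ↔ s • v ∈ N := Iff.rfl

/-- `W ≃ N`. -/
noncomputable def apdWEquiv (hV : ∀ r : R, r ≠ 0 → Function.Bijective fun v : V => r • v)
    (N : Submodule R V) (s : R) (hs : s ≠ 0) : apdW N s ≃ₗ[R] N :=
  LinearEquiv.ofBijective ((LinearMap.lsmul R V s).restrict (p := apdW N s) (q := N)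
    fun _ hx => hx) (by
    constructor
    · intro x y h
      exact Subtype.ext ((hV s hs).1 (congrArg Subtype.val h))
    · rintro ⟨y, hy⟩
      obtain ⟨x, rfl⟩ := (hV s hs).2 y
      exact ⟨⟨x, hy⟩, rfl⟩)

lemma apdWEquiv_coe (hV : ∀ r : R, r ≠ 0 → Function.Bijective fun v : V => r • v)
    (N : Submodule R V) (s : R) (hs : s ≠ 0) (x : apdW N s) :
    (apdWEquiv hV N s hs x : V) = s • (x : V) := rfl

lemma apd_mem_tor_mk {N : Submodule R V} {s : R} {v : V} :
    N.mkQ v ∈ apdTor (V ⧸ N) s ↔ ∃ n : ℕ, s ^ n • v ∈ N := by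
  refine exists_congr fun n => ?_
  rw [← map_smul, Submodule.mkQ_apply, Submodule.Quotient.mk_eq_zero]

lemma apd_quot_torsion {N : Submodule R V} (hN : ∀ v : V, ∃ r : R, r ≠ 0 ∧ r • v ∈ N) (x : V ⧸ N) :
    ∃ r : R, r ≠ 0 ∧ r • x = 0 := by
  obtain ⟨v, rfl⟩ := N.mkQ_surjective x
  obtain ⟨r, hr, h⟩ := hN v
  exact ⟨r, hr, by rwa [← map_smul, Submodule.mkQ_apply, Submodule.Quotient.mk_eq_zero]⟩

lemma apd_W_mono (N : Submodule R V) (s : R) : Monotone fun n : ℕ => apdW N (s ^ n) := by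
  intro i j hij x hx
  obtain ⟨k, rfl⟩ := Nat.exists_eq_add_of_le hij
  rw [apd_mem_W, pow_add, mul_comm, mul_smul]
  exact N.smul_mem _ hx

lemma apd_stepA (hR : IsAPD R) (hQ : ¬ IsField R)
    (hV : ∀ r : R, r ≠ 0 → Function.Bijective fun v : V => r • v) (N : Submodule R V)
    (hN : ∀ v : V, ∃ r : R, r ≠ 0 ∧ r • v ∈ N) (hp : ApdPD R 1 N) : ApdPD R 2 V := by
  have hT : ApdPD R 2 (V ⧸ N) := by
    refine apd_pd_torsion hR hQ (apd_quot_torsion hN) 1 fun s hs => ?_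
    have hU : ApdPD R 2 ((apdTor (V ⧸ N) s).comap N.mkQ) := by
      refine apd_telescope' 0 (fun n => apdW N (s ^ n)) _ (apd_W_mono N s) (fun x => ?_)
        fun k => apd_pd_equiv _ (apdWEquiv hV N (s ^ k) (pow_ne_zero k hs)) hp
      exact apd_mem_tor_mk
    refine (apd_ses (X := N) (Y := (apdTor (V ⧸ N) s).comap N.mkQ) (Z := apdTor (V ⧸ N) s)
      (Submodule.inclusion fun x hx => ?_)
      (N.mkQ.restrict fun _ hx => hx) (Submodule.inclusion_injective _) ?_
      ?_).hasProjectiveDimensionLT_X₃ 1 hp hU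
    · exact apd_mem_tor_mk.2 ⟨0, by simpa using hx⟩
    · rintro ⟨y, hy⟩
      obtain ⟨v, rfl⟩ := N.mkQ_surjective y
      exact ⟨⟨v, hy⟩, rfl⟩
    · rintro ⟨y, hy⟩
      rw [← Subtype.coe_inj]
      constructor
      · intro h
        have : y ∈ N := (Submodule.Quotient.mk_eq_zero _).1 h
        exact ⟨⟨y, this⟩, rfl⟩
      · rintro ⟨x, hx⟩
        have : y = x := (congrArg Subtype.val hx).symm
        exact (Submodule.Quotient.mk_eq_zero _).2 (this ▸ x.2)
  exact (apd_ses N.subtype N.mkQ (Submodule.injective_subtype _) N.mkQ_surjective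
    (LinearMap.exact_subtype_mkQ N)).hasProjectiveDimensionLT_X₂ 2
    (hasProjectiveDimensionLT_of_ge _ 1 2 (by omega)) hT

lemma apd_torBy (hR : IsAPD R)
    (hV : ∀ r : R, r ≠ 0 → Function.Bijective fun v : V => r • v) (N : Submodule R V)
    [Module.Flat R N] (s : R) (hs : s ≠ 0) : ApdPD R 2 (Submodule.torsionBy R (V ⧸ N) s) := by
  let e := apdWEquiv hV N s hs
  let g : apdW N s →ₗ[R] Submodule.torsionBy R (V ⧸ N) s := N.mkQ.restrict fun x hx => by
    rw [Submodule.mem_torsionBy_iff, ← map_smul, Submodule.mkQ_apply,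
      Submodule.Quotient.mk_eq_zero]
    exact hx
  let φ := g ∘ₗ e.symm.toLinearMap
  have hφ : Function.Surjective φ := by
    refine Function.Surjective.comp (g := g) ?_ e.symm.surjective
    rintro ⟨y, hy⟩
    obtain ⟨v, rfl⟩ := N.mkQ_surjective y
    rw [Submodule.mem_torsionBy_iff, ← map_smul, Submodule.mkQ_apply,
      Submodule.Quotient.mk_eq_zero] at hy
    exact ⟨⟨v, hy⟩, rfl⟩
  have hker : LinearMap.ker φ = Ideal.span {s} • (⊤ : Submodule R N) := by
    ext x
    obtain ⟨w, rfl⟩ := e.surjective x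
    rw [Submodule.ideal_span_singleton_smul, LinearMap.mem_ker]
    have h1 : φ (e w) = g w := by simp [φ]
    rw [h1, ← Subtype.coe_inj]
    have h2 : ((g w : V ⧸ N) = 0) ↔ (w : V) ∈ N := Submodule.Quotient.mk_eq_zero _
    refine h2.trans ⟨fun h => ⟨⟨w, h⟩, trivial, Subtype.ext rfl⟩, ?_⟩
    rintro ⟨y, -, hy⟩
    have h3 : s • (y : V) = s • (w : V) := congrArg Subtype.val hy
    have := (hV s hs).1 h3
    exact this ▸ y.2
  refine apd_pd_equiv 2 ((Submodule.quotEquivOfEq _ _ hker).symm ≪≫ₗ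
    φ.quotKerEquivOfSurjective hφ).symm ?_
  exact apd_pd_flatquot hR s hs N

lemma apd_stepB (hR : IsAPD R) (hQ : ¬ IsField R)
    (hV : ∀ r : R, r ≠ 0 → Function.Bijective fun v : V => r • v) (N : Submodule R V)
    (hN : ∀ v : V, ∃ r : R, r ≠ 0 ∧ r • v ∈ N) [Module.Flat R N] (hp : ApdPD R 2 V) :
    ApdPD R 2 N := by
  have hT : ApdPD R 3 (V ⧸ N) := by
    refine apd_pd_torsion hR hQ (apd_quot_torsion hN) 2 fun s hs => ?_
    refine apd_telescope' 1 (fun n => Submodule.torsionBy R (V ⧸ N) (s ^ n)) _ ?_ (fun x => ?_)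
        fun k => apd_torBy hR hV N (s ^ k) (pow_ne_zero k hs)
    · intro i j hij
      exact Submodule.torsionBy_le_torsionBy_of_dvd _ _ (pow_dvd_pow s hij)
    · rfl
  exact (apd_ses N.subtype N.mkQ (Submodule.injective_subtype _) N.mkQ_surjective
    (LinearMap.exact_subtype_mkQ N)).hasProjectiveDimensionLT_X₁ 2 hp hT

lemma apd_frac_bij [Module (FractionRing R) V] [IsScalarTower R (FractionRing R) V] (r : R)
    (hr : r ≠ 0) : Function.Bijective fun v : V => r • v := by
  have h0 : algebraMap R (FractionRing R) r ≠ 0 := by simpa using hr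
  have h1 : (fun v : V => r • v) = fun v : V => algebraMap R (FractionRing R) r • v := by
    ext v; rw [algebraMap_smul]
  rw [h1]
  exact MulAction.bijective₀ h0

lemma apd_pd_frac (hR : IsAPD R) (hQ : ¬ IsField R) : ApdPD R 2 (FractionRing R) := by
  refine apd_stepA hR hQ (fun r hr => apd_frac_bij r hr)
    (LinearMap.range (Algebra.linearMap R (FractionRing R))) (fun v => ?_) ?_
  · obtain ⟨a, b, hb, rfl⟩ := IsFractionRing.div_surjective (A := R) v
    have hb0 : b ≠ 0 := nonZeroDivisors.ne_zero hb
    refine ⟨b, hb0, a, ?_⟩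
    have : algebraMap R (FractionRing R) b ≠ 0 := by simpa using hb0
    rw [Algebra.smul_def, Algebra.linearMap_apply]
    field_simp
  · refine apd_pd_equiv 1 (LinearEquiv.ofInjective (Algebra.linearMap R (FractionRing R))
      (IsFractionRing.injective R (FractionRing R))).symm ?_
    exact apd_pd_proj inferInstance

lemma apd_pd_space (hR : IsAPD R) (hQ : ¬ IsField R) [Module (FractionRing R) V]
    [IsScalarTower R (FractionRing R) V] : ApdPD R 2 V := by
  let b := Module.Free.chooseBasis (FractionRing R) V
  exact apd_pd_equiv 2 (b.repr.restrictScalars R) (apd_pd_finsupp _ _ 1 (apd_pd_frac hR hQ))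

lemma apd_forward (hR : IsAPD R) (hQ : ¬ IsField R) (M : Type u) [AddCommGroup M] [Module R M]
    [Module.Flat R M] : ApdPD R 2 M := by
  let V := TensorProduct R (FractionRing R) M
  let f : M →ₗ[R] V := TensorProduct.mk R (FractionRing R) M 1
  have hf : Function.Injective f := by
    have h1 := Module.Flat.rTensor_preserves_injective_linearMap (M := M)
      (Algebra.linearMap R (FractionRing R)) (IsFractionRing.injective R (FractionRing R))
    have h2 : (f : M → V) = (LinearMap.rTensor M (Algebra.linearMap R (FractionRing R))) ∘
        (TensorProduct.lid R M).symm := by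
      ext x; simp [f]; rfl
    rw [h2]
    exact h1.comp (TensorProduct.lid R M).symm.injective
  let e := LinearEquiv.ofInjective f hf
  have hflat : Module.Flat R (LinearMap.range f) := Module.Flat.of_linearEquiv e.symm
  refine apd_pd_equiv 2 e (apd_stepB (V := V) hR hQ (fun r hr => apd_frac_bij r hr) _ (fun v => ?_)
    (apd_pd_space hR hQ))
  induction v using TensorProduct.induction_on with
  | zero => exact ⟨1, one_ne_zero, by simp⟩
  | tmul q x =>
    obtain ⟨a, b, hb, rfl⟩ := IsFractionRing.div_surjective (A := R) q
    have hb0 : b ≠ 0 := nonZeroDivisors.ne_zero hb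
    refine ⟨b, hb0, a • x, ?_⟩
    have : algebraMap R (FractionRing R) b ≠ 0 := by simpa using hb0
    show (1 : FractionRing R) ⊗ₜ[R] (a • x) = b • (_ ⊗ₜ[R] x)
    rw [← TensorProduct.smul_tmul, TensorProduct.smul_tmul', Algebra.smul_def, Algebra.smul_def]
    congr 1
    field_simp
  | add x y hx hy =>
    obtain ⟨a, ha, hx⟩ := hx
    obtain ⟨b, hb, hy⟩ := hy
    refine ⟨a * b, mul_ne_zero ha hb, ?_⟩
    rw [smul_add]
    refine add_mem ?_ ?_
    · rw [mul_comm, mul_smul]; exact Submodule.smul_mem _ _ hx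
    · rw [mul_smul]; exact Submodule.smul_mem _ _ hy

end Forward

/-- Over an almost perfect domain that is not a field, a module is flat iff it is
torsion-free and of projective dimension at most `1`. -/
theorem flat_iff_torsionFree_projDimLE_one (R : Type u) [CommRing R] [IsDomain R]
    (hR : IsAPD R) (hQ : ¬ IsField R) (M : Type u) [AddCommGroup M] [Module R M] :
    Module.Flat R M ↔
      (∀ (r : R) (m : M), r • m = 0 → r ≠ 0 → m = 0) ∧
        ProjDimLE R 1 (ModuleCat.of R M) := by
  constructor
  · intro h
    refine ⟨fun r m hm hr => ?_, apd_pd_final (apd_forward hR hQ M)⟩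
    have := Module.Flat.isSMulRegular_of_isRegular (M := M) (IsRegular.of_ne_zero hr)
    exact this (by simpa using hm)
  · rintro ⟨htf, hpd⟩
    exact apd_back' hR htf hpd
end

section
/- Let R be a 1-dimensional h-local domain with Q ≠ R. Then the projective dimension of Q as an R-module is 1, and the projective dimension of Q/R is 1 (so in particular R is a Matlis domain). -/
universe u

/-- An integral domain is `h`-local if every proper quotient is semilocal and every
quotient by a nonzero prime is local. -/
def IsHLocal (R : Type u) [CommRing R] [IsDomain R] : Prop :=
  (∀ I : Ideal R, I ≠ ⊥ → {m : Ideal (R ⧸ I) | m.IsMaximal}.Finite) ∧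
  (∀ P : Ideal R, P ≠ ⊥ → P.IsPrime → IsLocalRing (R ⧸ P))

/-- The localization `R_m` at a maximal ideal `m`, viewed as an `R`-submodule of the
fraction field `K`. -/
noncomputable def locAt (R K : Type u) [CommRing R] [IsDomain R] [Field K] [Algebra R K]
    [IsFractionRing R K] (m : Ideal R) (hm : m.IsMaximal) : Submodule R K :=
  haveI := hm.isPrime
  Subalgebra.toSubmodule (Localization.subalgebra K m.primeCompl
    (fun x hx => mem_nonZeroDivisors_of_ne_zero (fun h => hx (h ▸ m.zero_mem))))

/-- `R_(X) = ⋂_{m ∈ X} R_m ⊆ K` (equal to `K = Q` when `X = ∅`). -/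
noncomputable def locInt (R K : Type u) [CommRing R] [IsDomain R] [Field K] [Algebra R K]
    [IsFractionRing R K] (X : Set (Ideal R)) (hX : ∀ m ∈ X, m.IsMaximal) :
    Submodule R K :=
  ⨅ m : X, locAt R K m.1 (hX m.1 m.2)

/-- The copy of `R` inside its fraction field `K`, as an `R`-submodule. -/
noncomputable def ringInK (R K : Type u) [CommRing R] [IsDomain R] [Field K] [Algebra R K]
    [IsFractionRing R K] : Submodule R K :=
  LinearMap.range (Algebra.linearMap R K)

open CategoryTheory Limits

section pd
variable {R : Type u} [CommRing R]

lemma shortExact_of_maps {A B M : Type u} [AddCommGroup A] [AddCommGroup B] [AddCommGroup M]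
    [Module R A] [Module R B] [Module R M] (g : A →ₗ[R] B) (f : B →ₗ[R] M)
    (hg : Function.Injective g) (hf : Function.Surjective f) (hex : Function.Exact g f) :
    (ShortComplex.mk (ModuleCat.ofHom g) (ModuleCat.ofHom f)
      (by ext x; simpa using hex.apply_apply_eq_zero x)).ShortExact := by
  have : Mono (ModuleCat.ofHom g) := (ModuleCat.mono_iff_injective _).2 hg
  have : Epi (ModuleCat.ofHom f) := (ModuleCat.epi_iff_surjective _).2 hf
  exact
    { exact := (ShortComplex.ShortExact.moduleCat_exact_iff_function_exact _).2 hex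
      mono_f := ‹_›
      epi_g := ‹_› }

lemma pd_of_exact {A B M : Type u} [AddCommGroup A] [AddCommGroup B] [AddCommGroup M]
    [Module R A] [Module R B] [Module R M] [Module.Projective R A] [Module.Projective R B]
    (g : A →ₗ[R] B) (f : B →ₗ[R] M)
    (hg : Function.Injective g) (hf : Function.Surjective f) (hex : Function.Exact g f) :
    HasProjectiveDimensionLT (ModuleCat.of R M) 2 := by
  have hs := shortExact_of_maps g f hg hf hex
  have : Projective (ModuleCat.of R A) := (IsProjective.iff_projective _).1 inferInstance
  have : Projective (ModuleCat.of R B) := (IsProjective.iff_projective _).1 inferInstance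
  exact hs.hasProjectiveDimensionLT_X₃ 1 inferInstance inferInstance

lemma pd_ker {B M : Type u} [AddCommGroup B] [AddCommGroup M]
    [Module R B] [Module R M] [Module.Projective R B]
    (f : B →ₗ[R] M) (hf : Function.Surjective f) 
    (h : HasProjectiveDimensionLT (ModuleCat.of R M) 2) : Module.Projective R (LinearMap.ker f) := by
  have hs := shortExact_of_maps (LinearMap.ker f).subtype f (Submodule.subtype_injective _) hf
    (LinearMap.exact_subtype_ker_map f)
  have : Projective (ModuleCat.of R B) := (IsProjective.iff_projective _).1 inferInstance
  have := hs.hasProjectiveDimensionLT_X₁ 1 inferInstance h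
  exact (IsProjective.iff_projective (LinearMap.ker f)).2
    (projective_iff_hasProjectiveDimensionLT_one.2 this)

lemma projDimLE_one_of_pd {M : Type u} [AddCommGroup M] [Module R M]
    (h : HasProjectiveDimensionLT (ModuleCat.of R M) 2) : ProjDimLE R 1 (ModuleCat.of R M) := by
  let f : (M →₀ R) →ₗ[R] M := Finsupp.linearCombination R id
  have hf : Function.Surjective f := Finsupp.linearCombination_id_surjective R M
  have := pd_ker f hf h
  refine ⟨ModuleCat.of R (M →₀ R), ModuleCat.ofHom f, (ModuleCat.epi_iff_surjective _).2 hf,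
    (IsProjective.iff_projective _).1 inferInstance, ?_⟩
  have h2 : Projective (ModuleCat.of R (LinearMap.ker f)) :=
    (IsProjective.iff_projective _).1 inferInstance
  exact Projective.of_iso (ModuleCat.kernelIsoKer (ModuleCat.ofHom f)).symm h2

lemma pd_of_retract {N M : Type u} [AddCommGroup N] [AddCommGroup M]
    [Module R N] [Module R M] (i : N →ₗ[R] M) (p : M →ₗ[R] N) (h : ∀ x, p (i x) = x)
    (hM : HasProjectiveDimensionLT (ModuleCat.of R M) 2) :
    HasProjectiveDimensionLT (ModuleCat.of R N) 2 := by
  let r : Retract (ModuleCat.of R N) (ModuleCat.of R M) :=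
    ⟨ModuleCat.ofHom i, ModuleCat.ofHom p, by ext x; simpa using h x⟩
  exact r.hasProjectiveDimensionLT 2

lemma pd_dfinsupp_aux {ι : Type u} [DecidableEq ι] (A B M : ι → Type u)
    [∀ i, AddCommGroup (M i)] [∀ i, Module R (M i)]
    [∀ i, AddCommGroup (A i)] [∀ i, Module R (A i)]
    [∀ i, AddCommGroup (B i)] [∀ i, Module R (B i)]
    [∀ i, Module.Projective R (A i)] [∀ i, Module.Projective R (B i)]
    (g : ∀ i, A i →ₗ[R] B i) (f : ∀ i, B i →ₗ[R] M i)
    (hg : ∀ i, Function.Injective (g i)) (hf : ∀ i, Function.Surjective (f i))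
    (hex : ∀ i, Function.Exact (g i) (f i)) :
    HasProjectiveDimensionLT (ModuleCat.of R (Π₀ i, M i)) 2 := by
  have p1 : Module.Projective R (Π₀ i, A i) := inferInstance
  have p2 : Module.Projective R (Π₀ i, B i) := inferInstance
  refine pd_of_exact (A := Π₀ i, A i) (B := Π₀ i, B i) (DFinsupp.mapRange.linearMap g)
    (DFinsupp.mapRange.linearMap f) ?_ ?_ ?_
  · exact (DFinsupp.mapRange_injective _ (fun i => by simp)).2 hg
  · exact (DFinsupp.mapRange_surjective _ (fun i => by simp)).2 hf
  · intro y
    constructor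
    · intro hy
      have hy' : ∀ i, ∃ x, g i x = y i := fun i => by
        refine (hex i (y i)).1 ?_
        simpa using DFunLike.congr_fun hy i
      choose x hx using hy'
      classical
      refine ⟨DFinsupp.mk y.support fun i => x i, ?_⟩
      ext1 i
      by_cases hi : y i = 0 <;> simp [DFinsupp.mk_apply, hi, hx]
    · rintro ⟨x, rfl⟩
      ext1 i
      simpa using (hex i).apply_apply_eq_zero (x i)

lemma pd_directSum {ι : Type u} [DecidableEq ι] (M : ι → Type u) [∀ i, AddCommGroup (M i)]
    [∀ i, Module R (M i)] (h : ∀ i, HasProjectiveDimensionLT (ModuleCat.of R (M i)) 2) :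
    HasProjectiveDimensionLT (ModuleCat.of R (Π₀ i, M i)) 2 := by
  let f : ∀ i, (M i →₀ R) →ₗ[R] M i := fun i => Finsupp.linearCombination R id
  have hf : ∀ i, Function.Surjective (f i) := fun i => Finsupp.linearCombination_id_surjective R (M i)
  have hk : ∀ i, Module.Projective R (LinearMap.ker (f i)) := fun i => pd_ker (f i) (hf i) (h i)
  exact pd_dfinsupp_aux (fun i => LinearMap.ker (f i)) (fun i => (M i →₀ R)) M
    (fun i => (LinearMap.ker (f i)).subtype) f (fun i => Submodule.subtype_injective _) hf
    (fun i => LinearMap.exact_subtype_ker_map (f i))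

end pd

section decomp
variable {R : Type u} [CommRing R]

/-- Elements that vanish in the localization at `m`. -/
def locKer (M : Type u) [AddCommGroup M] [Module R M] (m : MaximalSpectrum R) :
    Submodule R M where
  carrier := {x | ∃ t : R, t ∉ m.asIdeal ∧ t • x = 0}
  zero_mem' := ⟨1, fun h => m.isMaximal.ne_top ((Ideal.eq_top_iff_one _).2 h), by simp⟩
  add_mem' := by
    rintro a b ⟨t, ht, hta⟩ ⟨s, hs, hsb⟩
    refine ⟨t * s, fun h => (m.isMaximal.isPrime.mem_or_mem h).elim ht hs, ?_⟩
    rw [smul_add, mul_smul, mul_smul, hsb, smul_comm, hta]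
    simp
  smul_mem' := by
    rintro c x ⟨t, ht, htx⟩
    exact ⟨t, ht, by rw [smul_comm, htx, smul_zero]⟩

/-- The `m`-primary part. -/
def primPart (M : Type u) [AddCommGroup M] [Module R M] (m : MaximalSpectrum R) :
    Submodule R M := ⨅ n : {n : MaximalSpectrum R // n ≠ m}, locKer M n.1

lemma mem_primPart {M : Type u} [AddCommGroup M] [Module R M] {m : MaximalSpectrum R} {x : M} :
    x ∈ primPart M m ↔ ∀ n, n ≠ m → ∃ t : R, t ∉ n.asIdeal ∧ t • x = 0 := by
  simp only [primPart, Submodule.mem_iInf, Subtype.forall]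
  rfl

lemma primPart_isInternal [DecidableEq (MaximalSpectrum R)] (M : Type u) [AddCommGroup M]
    [Module R M]
    (h1 : ∀ (x : M) (m n : MaximalSpectrum R), m ≠ n →
      ∃ s t : R, s ∉ m.asIdeal ∧ t ∉ n.asIdeal ∧ t • s • x = 0)
    (h2 : ∀ x : M, {m : MaximalSpectrum R | ∀ t : R, t • x = 0 → t ∈ m.asIdeal}.Finite) :
    DirectSum.IsInternal (primPart (R := R) M) := by
  rw [DirectSum.isInternal_submodule_iff_iSupIndep_and_iSup_eq_top]
  constructor
  · intro m
    rw [Submodule.disjoint_def]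
    intro x hx hx2
    have hx3 : x ∈ locKer M m := by
      refine (iSup₂_le (fun n hn => ?_) : _ ≤ locKer M m) hx2
      intro y hy
      exact mem_primPart.1 hy m (Ne.symm hn)
    have : Ideal.torsionOf R M x = ⊤ := by
      by_contra hne
      obtain ⟨n, hn, hle⟩ := Ideal.exists_le_maximal _ hne
      have : ∃ t : R, t ∉ n ∧ t • x = 0 := by
        by_cases hnm : (⟨n, hn⟩ : MaximalSpectrum R) = m
        · subst hnm; exact hx3
        · exact mem_primPart.1 hx ⟨n, hn⟩ hnm
      obtain ⟨t, ht, htx⟩ := this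
      exact ht (hle ((Ideal.mem_torsionOf_iff _ _).2 htx))
    have h := (Ideal.mem_torsionOf_iff x (1 : R)).1 (this ▸ Submodule.mem_top)
    simpa using h
  · rw [eq_top_iff]
    intro x _
    let J : Ideal R := (⨆ m, primPart (R := R) M m).comap (LinearMap.toSpanSingleton R M x)
    suffices hJ : J = ⊤ by
      have : (1 : R) ∈ J := hJ ▸ Submodule.mem_top
      simpa [J] using this
    by_contra hne
    obtain ⟨m', hm', hle⟩ := Ideal.exists_le_maximal _ hne
    let m : MaximalSpectrum R := ⟨m', hm'⟩
    choose! s t hs ht hst using fun n (hn : m ≠ n) => h1 x m n hn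
    let F := (h2 x).toFinset.erase m
    have hmem : ∏ n ∈ F, s n ∈ J := by
      change (∏ n ∈ F, s n) • x ∈ ⨆ m, primPart (R := R) M m
      refine Submodule.mem_iSup_of_mem m (mem_primPart.2 fun n hn => ?_)
      by_cases hF : n ∈ F
      · refine ⟨t n, ht n hn.symm, ?_⟩
        rw [← Finset.prod_erase_mul F s hF, mul_smul, smul_comm, hst n hn.symm, smul_zero]
      · have : ¬ ∀ t : R, t • x = 0 → t ∈ n.asIdeal := by
          intro h
          exact hF (Finset.mem_erase.2 ⟨hn, (h2 x).mem_toFinset.2 h⟩)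
        push Not at this
        obtain ⟨t, htx, htn⟩ := this
        exact ⟨t, htn, by rw [smul_comm, htx, smul_zero]⟩
    obtain ⟨n, hn, hn2⟩ := (hm'.isPrime.prod_mem_iff).1 (hle hmem)
    exact hs n (Finset.ne_of_mem_erase hn).symm hn2

lemma exists_mul_mem [IsDomain R] [Ring.KrullDimLE 1 R] (I : Ideal R) (hI : I ≠ ⊥)
    (m n : MaximalSpectrum R) (hmn : m ≠ n) :
    ∃ s t : R, s ∉ m.asIdeal ∧ t ∉ n.asIdeal ∧ t * s ∈ I := by
  have := m.isMaximal.isPrime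
  have := n.isMaximal.isPrime
  by_contra hcon
  push Not at hcon
  obtain ⟨P, hP, hIP, hd⟩ := Ideal.exists_le_prime_disjoint I
    (m.asIdeal.primeCompl ⊔ n.asIdeal.primeCompl) (by
      rw [Set.disjoint_left]
      intro x hx hx2
      obtain ⟨s, hs, t, ht, rfl⟩ := Submonoid.mem_sup.1 hx2
      exact hcon s t hs ht (by rwa [mul_comm]))
  have hPm : P.IsMaximal := hP.isMaximal_of_ne_bot (by rintro rfl; exact hI (le_bot_iff.1 hIP))
  rw [Set.disjoint_left] at hd
  have e1 : P = m.asIdeal := hPm.eq_of_le m.isMaximal.ne_top fun x hx => by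
    by_contra h
    exact hd hx (Submonoid.mem_sup_left (S := m.asIdeal.primeCompl) h)
  have e2 : P = n.asIdeal := hPm.eq_of_le n.isMaximal.ne_top fun x hx => by
    by_contra h
    exact hd hx (Submonoid.mem_sup_right (T := n.asIdeal.primeCompl) h)
  exact hmn (MaximalSpectrum.ext (e1.symm.trans e2))

lemma pow_smul_eq_zero [IsDomain R] [Ring.KrullDimLE 1 R] {M : Type u} [AddCommGroup M]
    [Module R M] (m : MaximalSpectrum R) (r : R) (hr : r ∈ m.asIdeal) (x : M)
    (hx : x ∈ primPart M m) (hI : Ideal.torsionOf R M x ≠ ⊥) : ∃ k : ℕ, r ^ k • x = 0 := by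
  suffices h : r ∈ (Ideal.torsionOf R M x).radical by
    obtain ⟨k, hk⟩ := h
    exact ⟨k, (Ideal.mem_torsionOf_iff _ _).1 hk⟩
  rw [Ideal.radical_eq_sInf, Submodule.mem_sInf]
  intro (P : Ideal R) hPP
  obtain ⟨hle, hP⟩ : Ideal.torsionOf R M x ≤ P ∧ P.IsPrime := hPP
  have hPm : P.IsMaximal := hP.isMaximal_of_ne_bot (by rintro rfl; exact hI (le_bot_iff.1 hle))
  by_cases h : (⟨P, hPm⟩ : MaximalSpectrum R) = m
  · subst h; exact hr
  · obtain ⟨t, ht, htx⟩ := mem_primPart.1 hx _ h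
    exact absurd (hle ((Ideal.mem_torsionOf_iff _ _).2 htx)) ht

end decomp

section away
open Polynomial
variable {R K : Type u} [CommRing R] [IsDomain R] [Field K] [Algebra R K] [IsFractionRing R K]

/-- The map `R[X] → K / R`, `X ↦ 1 / r`. -/
noncomputable def awayMap (R K : Type u) [CommRing R] [IsDomain R] [Field K] [Algebra R K]
    [IsFractionRing R K] (r : R) : R[X] →ₗ[R] (K ⧸ ringInK R K) :=
  (ringInK R K).mkQ ∘ₗ (aeval (R := R) ((algebraMap R K r)⁻¹)).toLinearMap

lemma dvd_of_aeval_inv (r : R) (hr : r ≠ 0) (p : R[X])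
    (hp : aeval ((algebraMap R K r)⁻¹) p = 0) : C r * X - 1 ∣ p := by
  have hr' : algebraMap R K r ≠ 0 := by simpa using hr
  have := IsLocalization.adjoin_inv r
  rw [← AdjoinRoot.mk_eq_zero]
  obtain ⟨⟨a, ⟨_, k, rfl⟩⟩, h⟩ := IsLocalization.surj (Submonoid.powers r)
    (AdjoinRoot.mk (C r * X - 1) p)
  let φ : AdjoinRoot (C r * X - 1) →+* K :=
    AdjoinRoot.lift (algebraMap R K) ((algebraMap R K r)⁻¹) (by simp [hr'])
  have h2 := congrArg φ h
  have e : ∀ b : R, φ (algebraMap R _ b) = algebraMap R K b := fun b => by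
    simp [φ, AdjoinRoot.algebraMap_eq]
  have e2 : φ (AdjoinRoot.mk (C r * X - 1) p) = 0 := by
    simpa [φ, AdjoinRoot.lift_mk, aeval_def] using hp
  rw [map_mul, e, e, e2, zero_mul] at h2
  have ha : a = 0 := by simpa using h2.symm
  have hu := IsLocalization.map_units (AdjoinRoot (C r * X - 1)) (⟨r ^ k, k, rfl⟩ : Submonoid.powers r)
  simp only [ha, map_zero] at h
  exact hu.mul_left_eq_zero.1 h

lemma awayMap_pd (r : R) (hr : r ≠ 0) :
    HasProjectiveDimensionLT (ModuleCat.of R (LinearMap.range (awayMap R K r))) 2 := by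
  have hr' : algebraMap R K r ≠ 0 := by simpa using hr
  refine pd_of_exact (A := R[X] × R) (B := R[X])
    ((LinearMap.mulLeft R (C r * X - 1)).coprod (Algebra.linearMap R R[X]))
    (awayMap R K r).rangeRestrict ?_ (LinearMap.surjective_rangeRestrict _) ?_
  · rw [← LinearMap.ker_eq_bot, LinearMap.ker_eq_bot']
    rintro ⟨p, c⟩ h
    have h : (C r * X - 1) * p + C c = 0 := by simpa using h
    have hd : (C r * X - 1 : R[X]).natDegree = 1 := by
      have := natDegree_linear (b := (-1 : R)) hr
      simpa [sub_eq_add_neg] using this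
    have hp : p = 0 := by
      by_contra hp
      have h3 : (C r * X - 1) * p = C (-c) := by
        rw [C_neg]; exact eq_neg_of_add_eq_zero_left h
      have h4 := congrArg natDegree h3
      rw [natDegree_C, natDegree_mul (by intro h0; simp [h0] at hd) hp, hd] at h4
      omega
    subst hp
    simpa using h
  · intro q
    constructor
    · intro hq
      have hq : awayMap R K r q = 0 := congrArg Subtype.val hq
      obtain ⟨c, hc⟩ : aeval ((algebraMap R K r)⁻¹) q ∈ ringInK R K := by
        simpa [awayMap] using hq
      obtain ⟨p, hp⟩ := dvd_of_aeval_inv (K := K) r hr (q - C c) (by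
        rw [map_sub, ← hc]; simp)
      refine ⟨(p, c), ?_⟩
      simp [← hp]
    · rintro ⟨⟨p, c⟩, rfl⟩
      apply Subtype.ext
      refine (Submodule.Quotient.mk_eq_zero _).2 ?_
      refine ⟨c, ?_⟩
      simp [hr']

lemma mem_range_awayMap (r : R) (hr : r ≠ 0) (x : K ⧸ ringInK R K) (k : ℕ)
    (hx : r ^ k • x = 0) : x ∈ LinearMap.range (awayMap R K r) := by
  have hr' : algebraMap R K r ≠ 0 := by simpa using hr
  obtain ⟨y, rfl⟩ := Submodule.Quotient.mk_surjective _ x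
  rw [← Submodule.Quotient.mk_smul, Submodule.Quotient.mk_eq_zero] at hx
  obtain ⟨c, hc⟩ := hx
  refine ⟨monomial k c, ?_⟩
  have : y = algebraMap R K c * ((algebraMap R K r)⁻¹) ^ k := by
    rw [Algebra.linearMap_apply, Algebra.smul_def, map_pow] at hc
    rw [hc, inv_pow]; field_simp
  simp [awayMap, this, aeval_monomial]

lemma torsion_quot (x : K ⧸ ringInK R K) : ∃ r : R, r ≠ 0 ∧ r • x = 0 := by
  obtain ⟨y, rfl⟩ := Submodule.Quotient.mk_surjective _ x
  obtain ⟨⟨a, b⟩, h⟩ := IsLocalization.surj (nonZeroDivisors R) y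
  refine ⟨b, nonZeroDivisors.ne_zero b.2, ?_⟩
  rw [← Submodule.Quotient.mk_smul, Submodule.Quotient.mk_eq_zero]
  exact ⟨a, by rw [Algebra.smul_def, mul_comm, h]; simp⟩

end away

section main
variable {R K : Type u} [CommRing R] [IsDomain R] [Field K] [Algebra R K] [IsFractionRing R K]

lemma torsionOf_ne_bot (x : K ⧸ ringInK R K) : Ideal.torsionOf R _ x ≠ ⊥ := by
  obtain ⟨r, hr, hx⟩ := torsion_quot x
  intro h
  exact hr (by simpa [h] using (Ideal.mem_torsionOf_iff x r).2 hx)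

lemma finite_maximal (hR : IsHLocal R) (I : Ideal R) (hI : I ≠ ⊥) :
    {m : MaximalSpectrum R | I ≤ m.asIdeal}.Finite := by
  refine Set.Finite.of_finite_image (f := fun m : MaximalSpectrum R => m.asIdeal) ?_
    (fun a _ b _ h => MaximalSpectrum.ext h)
  refine ((hR.1 I hI).image (Ideal.comap (Ideal.Quotient.mk I))).subset ?_
  rintro _ ⟨m, hm, rfl⟩
  have hs := Ideal.Quotient.mk_surjective (I := I)
  have hc : Ideal.comap (Ideal.Quotient.mk I) (Ideal.map (Ideal.Quotient.mk I) m.asIdeal)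
      = m.asIdeal := by
    rw [Ideal.comap_map_of_surjective _ hs, ← RingHom.ker_eq_comap_bot, Ideal.mk_ker]
    exact sup_eq_left.2 hm
  refine ⟨Ideal.map (Ideal.Quotient.mk I) m.asIdeal, ?_, hc⟩
  have := m.isMaximal
  rcases Ideal.map_eq_top_or_isMaximal_of_surjective _ hs m.isMaximal with h | h
  · rw [h, Ideal.comap_top] at hc
    exact absurd hc.symm m.isMaximal.ne_top
  · exact h

lemma quot_pd (hR : IsHLocal R) [Ring.KrullDimLE 1 R] (hQ : ¬ IsField R) :
    HasProjectiveDimensionLT (ModuleCat.of R (K ⧸ ringInK R K)) 2 := by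
  classical
  have hint : DirectSum.IsInternal (primPart (R := R) (K ⧸ ringInK R K)) := by
    refine primPart_isInternal _ ?_ ?_
    · intro x m n hmn
      obtain ⟨s, t, hs, ht, hst⟩ := exists_mul_mem _ (torsionOf_ne_bot x) m n hmn
      exact ⟨s, t, hs, ht, by rw [← mul_smul]; exact (Ideal.mem_torsionOf_iff _ _).1 hst⟩
    · intro x
      exact finite_maximal hR _ (torsionOf_ne_bot x)
  let e : (Π₀ m : MaximalSpectrum R, primPart (R := R) (K ⧸ ringInK R K) m) ≃ₗ[R]
      (K ⧸ ringInK R K) :=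
    LinearEquiv.ofBijective (DirectSum.coeLinearMap (primPart (R := R) (K ⧸ ringInK R K))) hint
  have he : ∀ m (x : primPart (R := R) (K ⧸ ringInK R K) m),
      e (DFinsupp.single m x) = x := fun m x =>
    DirectSum.coeLinearMap_of (primPart (R := R) (K ⧸ ringInK R K)) m x
  refine pd_of_retract e.symm.toLinearMap e.toLinearMap (by simp) (pd_directSum _ fun m => ?_)
  obtain ⟨r, hrm, hr⟩ := Submodule.exists_mem_ne_zero_of_ne_bot
    (Ring.ne_bot_of_isMaximal_of_not_isField m.isMaximal hQ)
  have hle : primPart (K ⧸ ringInK R K) m ≤ LinearMap.range (awayMap R K r) := by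
    intro x hx
    obtain ⟨k, hk⟩ := pow_smul_eq_zero m r hrm x hx (torsionOf_ne_bot x)
    exact mem_range_awayMap r hr x k hk
  refine pd_of_retract (Submodule.inclusion hle)
    ((DFinsupp.lapply m ∘ₗ e.symm.toLinearMap) ∘ₗ (LinearMap.range (awayMap R K r)).subtype) ?_
    (awayMap_pd (K := K) r hr)
  intro x
  have : e.symm x = DFinsupp.single m x := by rw [LinearEquiv.symm_apply_eq, he]
  simp [this]

lemma field_pd (hR : IsHLocal R) [Ring.KrullDimLE 1 R] (hQ : ¬ IsField R) :
    HasProjectiveDimensionLT (ModuleCat.of R K) 2 := by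
  have hs := shortExact_of_maps (Algebra.linearMap R K) (ringInK R K).mkQ
    (IsFractionRing.injective R K) (Submodule.mkQ_surjective _) (by
      intro y; exact Submodule.Quotient.mk_eq_zero _)
  have : Projective (ModuleCat.of R R) := (IsProjective.iff_projective _).1 inferInstance
  exact hs.hasProjectiveDimensionLT_X₂ 2
    (hasProjectiveDimensionLT_of_ge (ModuleCat.of R R) 1 2 (by norm_num)) (quot_pd hR hQ)

lemma quot_not_projective (hQ : ¬ IsField R) :
    ¬ Module.Projective R (K ⧸ ringInK R K) := by
  intro h
  have : Module.IsTorsionFree R (K ⧸ ringInK R K) := inferInstance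
  have hz : ∀ x : K ⧸ ringInK R K, x = 0 := fun x => by
    obtain ⟨r, hr, hx⟩ := torsion_quot x
    exact (smul_eq_zero.1 hx).resolve_left hr
  refine hQ ?_
  have hb : Function.Bijective (algebraMap R K) := by
    refine ⟨IsFractionRing.injective R K, fun y => ?_⟩
    exact (Submodule.Quotient.mk_eq_zero _).1 (hz (Submodule.Quotient.mk y))
  exact MulEquiv.isField (Field.toIsField K) (RingEquiv.ofBijective (algebraMap R K) hb).toMulEquiv

lemma field_not_projective (hQ : ¬ IsField R) : ¬ Module.Projective R K := by
  intro h
  obtain ⟨r, hr, hru⟩ := Ring.exists_not_isUnit_of_not_isField hQ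
  obtain ⟨s, hs⟩ := h.out
  have h1 : s 1 ≠ 0 := by
    intro h0
    have := hs 1
    rw [h0] at this
    simp at this
  obtain ⟨i, hi⟩ := Finsupp.ne_iff.1 h1
  set a := s 1 i with ha
  have ha0 : a ≠ 0 := hi
  have hne : algebraMap R K (a * r) ≠ 0 := by simpa using ⟨ha0, hr⟩
  have h2 : s ((a * r) • (algebraMap R K (a * r))⁻¹) i = a := by
    rw [Algebra.smul_def, mul_inv_cancel₀ hne]
  rw [map_smul, Finsupp.smul_apply, smul_eq_mul, mul_assoc] at h2
  exact hru (IsUnit.of_mul_eq_one _ (mul_left_cancel₀ ha0 (h2.trans (mul_one a).symm)))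

end main

/-- Over a 1-dimensional `h`-local domain `R` that is not a field, both `Q` and `Q/R`
have projective dimension exactly `1`; in particular `R` is a Matlis domain. -/
theorem projDim_Q_and_QmodR_eq_one (R K : Type u) [CommRing R] [IsDomain R] [Field K]
    [Algebra R K] [IsFractionRing R K] (hR : IsHLocal R) (hdim : ringKrullDim R = 1)
    (hQ : ¬ IsField R) :
    (ProjDimLE R 1 (ModuleCat.of R K) ∧ ¬ ProjDimLE R 0 (ModuleCat.of R K)) ∧
    (ProjDimLE R 1 (ModuleCat.of R (K ⧸ ringInK R K)) ∧
      ¬ ProjDimLE R 0 (ModuleCat.of R (K ⧸ ringInK R K))) := by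
  have : Ring.KrullDimLE 1 R := Ring.krullDimLE_iff.2 (by rw [hdim]; simp)
  exact ⟨⟨projDimLE_one_of_pd (field_pd hR hQ),
      fun h => field_not_projective hQ ((IsProjective.iff_projective K).2 h)⟩,
    projDimLE_one_of_pd (quot_pd hR hQ),
      fun h => quot_not_projective (K := K) hQ ((IsProjective.iff_projective _).2 h)⟩
end

section
/- Let R be a domain and S ⊆ R \ {0} a multiplicative subset such that pd_R(S⁻¹R) ≤ 1. Then the class of S⁻¹R-generated R-modules equals the class of S-divisible R-modules: an R-module M satisfies M ∈ Gen(S⁻¹R) (M is a quotient of a direct sum of copies of S⁻¹R) if and only if sM = M for every s ∈ S. -/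
universe u

open CategoryTheory Limits

section GenLoc

/-- The localization at a submonoid, as an `R`-submodule of `Q`. -/
def locSub {R : Type u} [CommRing R] (Q : Type u) [CommRing Q] [Algebra R Q]
    (S' : Submonoid R) : Submodule R Q where
  carrier := {x | ∃ s ∈ S', ∃ r : R, s • x = algebraMap R Q r}
  zero_mem' := ⟨1, S'.one_mem, 0, by simp⟩
  add_mem' := by
    rintro x y ⟨s, hs, r, hr⟩ ⟨t, ht, q, hq⟩
    refine ⟨s * t, S'.mul_mem hs ht, t * r + s * q, ?_⟩
    rw [smul_add, map_add, map_mul, map_mul, ← hr, ← hq]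
    simp only [Algebra.smul_def, map_mul]; ring
  smul_mem' := by
    rintro a x ⟨s, hs, r, hr⟩
    refine ⟨s, hs, a * r, ?_⟩
    rw [map_mul, ← hr]
    simp only [Algebra.smul_def]; ring

variable {R : Type u} [CommRing R] {Q : Type u} [CommRing Q] [Algebra R Q]

theorem mem_locSub {S' : Submonoid R} {x : Q} :
    x ∈ locSub Q S' ↔ ∃ s ∈ S', ∃ r : R, s • x = algebraMap R Q r := Iff.rfl

theorem locSub_mono {S' S'' : Submonoid R} (h : S' ≤ S'') : locSub Q S' ≤ locSub Q S'' := by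
  rintro x ⟨s, hs, r, hr⟩
  exact ⟨s, h hs, r, hr⟩

theorem algebraMap_mem_locSub (S' : Submonoid R) (r : R) : algebraMap R Q r ∈ locSub Q S' :=
  ⟨1, S'.one_mem, r, by simp⟩

theorem one_mem_locSub (S' : Submonoid R) : (1 : Q) ∈ locSub Q S' :=
  ⟨1, S'.one_mem, 1, by simp⟩

theorem mul_mem_locSub {S' : Submonoid R} {x y : Q} (hx : x ∈ locSub Q S')
    (hy : y ∈ locSub Q S') : x * y ∈ locSub Q S' := by
  obtain ⟨s, hs, r, hr⟩ := hx
  obtain ⟨t, ht, q, hq⟩ := hy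
  refine ⟨s * t, S'.mul_mem hs ht, r * q, ?_⟩
  rw [map_mul, ← hr, ← hq]
  simp only [Algebra.smul_def, map_mul]; ring

theorem inv_mem_locSub {S' : Submonoid R} {s : R} (hs : s ∈ S') {u : Q} (hu : s • u = 1) :
    u ∈ locSub Q S' := ⟨s, hs, 1, by simpa using hu⟩

theorem cancel_of_inv {t : R} (ht : ∃ u : Q, t • u = 1) {x y : Q} (h : t • x = t • y) :
    x = y := by
  obtain ⟨u, hu⟩ := ht
  calc x = (t • u) * x := by rw [hu, one_mul]
    _ = u * (t • x) := by simp only [Algebra.smul_def]; ring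
    _ = u * (t • y) := by rw [h]
    _ = (t • u) * y := by simp only [Algebra.smul_def]; ring
    _ = y := by rw [hu, one_mul]

/-- The key ring theoretic property of a submonoid. -/
def GoodSub (Q : Type u) [CommRing Q] [Algebra R Q] (S S' : Submonoid R) : Prop :=
  ∀ T ∈ S, (∀ x ∈ locSub Q S', ∃ r : R, ∃ y ∈ locSub Q S', x = algebraMap R Q r + T • y) ∧
    ∃ e : R, ∃ y₀ ∈ locSub Q S', algebraMap R Q (1 - e) = T • y₀ ∧
      ∀ r : R, ∀ y ∈ locSub Q S', algebraMap R Q r = T • y → ∃ w, e * r = T * w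

variable {D : Type u} [AddCommGroup D] [Module R D]

theorem good_ext {S S' : Submonoid R} (hinv : ∀ t ∈ S, ∃ u : Q, t • u = 1)
    (hgood : GoodSub Q S S') (hD : ∀ s ∈ S, ∀ m : D, ∃ x : D, s • x = m)
    {T : R} (hT : T ∈ S) (g : locSub Q S' →ₗ[R] D) :
    ∃ g' : locSub Q S' →ₗ[R] D, ∀ x, g' (T • x) = g x := by
  obtain ⟨h1, e, y₀, hy₀, he, hk⟩ := hgood T hT
  let one : locSub Q S' := ⟨1, one_mem_locSub S'⟩
  obtain ⟨d, hd⟩ := hD T hT (g one)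
  let Y₀ : locSub Q S' := ⟨y₀, hy₀⟩
  set c : D := e • d + g Y₀ with hc
  have hTY : T • Y₀ = (1 - e) • one := by
    apply Subtype.ext
    simp only [Y₀, one, Submodule.coe_smul, ← he, Algebra.algebraMap_eq_smul_one]
  -- the compatibility
  have key : ∀ r : R, ∀ y : locSub Q S', r • one = T • y → r • c = g y := by
    intro r y hry
    obtain ⟨w, hw⟩ := hk r y y.2 (by
      have := congrArg Subtype.val hry
      simpa [one, Algebra.algebraMap_eq_smul_one] using this)
    have e1 : y = w • one + r • Y₀ := by
      apply Subtype.ext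
      apply cancel_of_inv (hinv T hT)
      have : T • y = T • (w • one + r • Y₀) := by
        rw [smul_add, smul_comm T r, hTY, ← hry, smul_smul, ← hw, smul_smul, ← add_smul]
        congr 1; ring
      simpa using congrArg Subtype.val this
    rw [e1, map_add, map_smul, map_smul, hc, smul_add, ← hd, smul_smul, smul_smul, mul_comm r e,
      hw, mul_comm w]
  choose! r y hy hx using h1
  let ry : locSub Q S' → locSub Q S' := fun x => ⟨y x, hy x x.2⟩
  have hx' : ∀ x : locSub Q S', x = r x • one + T • ry x := by
    intro x
    apply Subtype.ext
    have := hx x x.2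
    simpa [one, ry, Algebra.algebraMap_eq_smul_one] using this
  have key2 : ∀ (x : locSub Q S') (a : R) (z : locSub Q S'), x = a • one + T • z →
      r x • c + g (ry x) = a • c + g z := by
    intro x a z h
    have : (r x - a) • one = T • (z - ry x) := by
      have h3 := (hx' x).symm.trans h
      have h4 := congrArg Subtype.val h3
      apply Subtype.ext
      simp only [Submodule.coe_add, Submodule.coe_smul, Submodule.coe_sub, Algebra.smul_def,
        map_sub] at h4 ⊢
      linear_combination h4
    have := key _ _ this
    rw [sub_smul, map_sub, sub_eq_sub_iff_add_eq_add] at this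
    rw [this, add_comm]
  refine ⟨{ toFun := fun x => r x • c + g (ry x), map_add' := ?_, map_smul' := ?_ }, ?_⟩
  · intro x z
    rw [key2 (x + z) (r x + r z) (ry x + ry z)]
    · rw [add_smul, map_add]; abel
    · conv_lhs => rw [hx' x, hx' z]
      rw [add_smul, smul_add]; abel
  · intro a x
    simp only [RingHom.id_apply]
    rw [key2 (a • x) (a * r x) (a • ry x)]
    · rw [mul_smul, map_smul, ← smul_add]
    · conv_lhs => rw [hx' x]
      rw [smul_add, mul_smul, smul_comm T a]
  · intro x
    change r (T • x : locSub Q S') • c + g (ry (T • x)) = g x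
    rw [key2 (T • x) 0 x (by simp)]
    simp

/-- One-step extension for partial maps. -/
theorem good_ext_pmap {S S' : Submonoid R} (hinv : ∀ t ∈ S, ∃ u : Q, t • u = 1)
    (hgood : GoodSub Q S S') (hD : ∀ s ∈ S, ∀ m : D, ∃ x : D, s • x = m)
    {T t : R} (hT : T ∈ S) (ht : t ∈ S) (f : Q →ₗ.[R] D)
    (hf : f.domain = (locSub Q S').comap (LinearMap.lsmul R Q T)) :
    ∃ f' : Q →ₗ.[R] D, f ≤ f' ∧
      f'.domain = (locSub Q S').comap (LinearMap.lsmul R Q (T * t)) := by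
  obtain ⟨u, hu⟩ := hinv T hT
  have hTu : ∀ x : Q, T • (u * x) = x := by
    intro x; rw [← smul_mul_assoc, hu, one_mul]
  let g : locSub Q S' →ₗ[R] D := f.toFun ∘ₗ
    (LinearMap.codRestrict f.domain ((LinearMap.mulLeft R u) ∘ₗ (locSub Q S').subtype) (by
      intro x
      rw [hf]
      simp [hTu]))
  obtain ⟨g', hg'⟩ := good_ext hinv hgood hD ht g
  refine ⟨⟨(locSub Q S').comap (LinearMap.lsmul R Q (T * t)),
    g' ∘ₗ ((LinearMap.lsmul R Q (T * t)).restrict (fun x hx => hx))⟩, ⟨?_, ?_⟩, rfl⟩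
  · rw [hf]
    intro x hx
    simp only [Submodule.mem_comap, LinearMap.lsmul_apply] at hx ⊢
    rw [mul_comm, mul_smul]
    exact Submodule.smul_mem _ _ hx
  · rintro ⟨x, hx⟩ ⟨y, hy⟩ hxy
    obtain rfl : x = y := hxy
    have hx2 : T • x ∈ locSub Q S' := by
      rw [hf] at hx; exact hx
    have e1 : f.toFun ⟨x, hx⟩ = g ⟨T • x, hx2⟩ := by
      change f.toFun _ = f.toFun _
      congr 1
      apply Subtype.ext
      simp only [LinearMap.codRestrict_apply, LinearMap.comp_apply, LinearMap.mulLeft_apply,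
        Submodule.subtype_apply]
      rw [mul_smul_comm, hTu]
    change f.toFun _ = g' _
    rw [e1, ← hg']
    congr 1
    apply Subtype.ext
    simp [LinearMap.restrict_apply, mul_comm T t, mul_smul]

theorem good_ext_countable {S S' : Submonoid R} (hinv : ∀ t ∈ S, ∃ u : Q, t • u = 1)
    (hgood : GoodSub Q S S') (hD : ∀ s ∈ S, ∀ m : D, ∃ x : D, s • x = m)
    (X : Submonoid R) (hX : X ≤ S) (hXc : (X : Set R).Countable) (f : Q →ₗ.[R] D)
    (hf : f.domain = locSub Q S') :
    ∃ f' : Q →ₗ.[R] D, f ≤ f' ∧ f'.domain = locSub Q (S' ⊔ X) := by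
  obtain ⟨t, ht⟩ := hXc.exists_eq_range ⟨1, X.one_mem⟩
  have htX : ∀ n, t n ∈ X := fun n => by
    have : t n ∈ (X : Set R) := ht ▸ Set.mem_range_self n
    exact this
  let T : ℕ → R := fun n => ∏ i ∈ Finset.range n, t i
  have hTX : ∀ n, T n ∈ X := fun n => X.prod_mem (fun i _ => htX i)
  let Fn : ℕ → Type u := fun n => {f' : Q →ₗ.[R] D //
    f'.domain = (locSub Q S').comap (LinearMap.lsmul R Q (T n))}
  have hstep : ∀ n (a : Fn n), ∃ b : Fn (n + 1), a.1 ≤ b.1 := by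
    intro n a
    obtain ⟨f', h1, h2⟩ := good_ext_pmap hinv hgood hD (hX (hTX n)) (hX (htX n)) a.1 a.2
    exact ⟨⟨f', by rw [h2]; simp only [T, Finset.prod_range_succ]⟩, h1⟩
  choose nxt hnxt using hstep
  let F : (n : ℕ) → Fn n := fun n => Nat.rec (motive := Fn)
    ⟨f, by rw [hf]; ext x; simp [T]⟩ (fun n a => nxt n a) n
  let G : ℕ → Q →ₗ.[R] D := fun n => (F n).1
  have hG0 : G 0 = f := rfl
  have hmono : Monotone G := monotone_nat_of_le_succ (fun n => hnxt n (F n))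
  have hdir : DirectedOn (· ≤ ·) (Set.range G) := hmono.directed_le.directedOn_range
  refine ⟨LinearPMap.sSup (Set.range G) hdir, ?_, ?_⟩
  · exact LinearPMap.le_sSup hdir ⟨0, hG0⟩
  · ext x
    rw [LinearPMap.mem_domain_sSup_iff (Set.range_nonempty G) hdir]
    constructor
    · rintro ⟨_, ⟨n, rfl⟩, hx⟩
      have : x ∈ (F n).1.domain := hx
      rw [(F n).2] at this
      obtain ⟨s, hs, r, hr⟩ := (this : T n • x ∈ locSub Q S')
      exact ⟨s * T n, mul_mem (Submonoid.mem_sup_left hs) (Submonoid.mem_sup_right (hTX n)), r,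
        by rw [mul_smul]; exact hr⟩
    · rintro ⟨s, hs, r, hr⟩
      obtain ⟨a, ha, b, hb, rfl⟩ := Submonoid.mem_sup.1 hs
      obtain ⟨n, rfl⟩ : b ∈ Set.range t := ht ▸ hb
      refine ⟨_, ⟨n + 1, rfl⟩, ?_⟩
      change x ∈ (F (n + 1)).1.domain
      rw [(F (n + 1)).2]
      change T (n + 1) • x ∈ locSub Q S'
      have : T (n + 1) = T n * t n := Finset.prod_range_succ _ _
      rw [this, mul_smul]
      apply Submodule.smul_mem
      exact ⟨a, ha, r, by rw [← mul_smul, hr]⟩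

variable {P J : Type u}

/-- Closed triples: submonoid, subset of the basis, subset of the relations. -/
structure Tri (S : Submonoid R) (π : (P →₀ R) →ₗ[R] Q)
    (ι : LinearMap.ker π →ₗ[R] (J →₀ R)) (ρ : (J →₀ R) →ₗ[R] LinearMap.ker π) (p₀ : P)
    (S' : Submonoid R) (I' : Set P) (J' : Set J) : Prop where
  le : S' ≤ S
  p0 : p₀ ∈ I'
  hI : ∀ i ∈ I', π (Finsupp.single i 1) ∈ locSub Q S'
  hsurj : ∀ x ∈ locSub Q S', ∃ g ∈ Finsupp.supported R R I', π g = x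
  hρ : ∀ j ∈ J', (ρ (Finsupp.single j 1) : P →₀ R) ∈ Finsupp.supported R R I'
  hι : ∀ l : LinearMap.ker π, (l : P →₀ R) ∈ Finsupp.supported R R I' →
    ι l ∈ Finsupp.supported R R J'

theorem supported_map {A B : Type u} [AddCommGroup B] [Module R B] {I' : Set A}
    (f : (A →₀ R) →ₗ[R] B) (N : Submodule R B) (h : ∀ i ∈ I', f (Finsupp.single i 1) ∈ N)
    {g : A →₀ R} (hg : g ∈ Finsupp.supported R R I') : f g ∈ N := by
  rw [Finsupp.supported_eq_span_single] at hg
  have : Submodule.span R ((fun i => Finsupp.single i (1 : R)) '' I') ≤ N.comap f := by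
    rw [Submodule.span_le]
    rintro _ ⟨i, hi, rfl⟩
    exact h i hi
  exact this hg

theorem pi_eq_sum (π : (P →₀ R) →ₗ[R] Q) (g : P →₀ R) {F : Finset P} (hF : g.support ⊆ F) :
    π g = ∑ i ∈ F, g i • π (Finsupp.single i 1) := by
  conv_lhs => rw [← Finsupp.sum_single g]
  rw [Finsupp.sum_of_support_subset g hF _ (by simp), map_sum]
  refine Finset.sum_congr rfl fun i _ => ?_
  rw [← map_smul, Finsupp.smul_single, smul_eq_mul, mul_one]

theorem Tri.good {S : Submonoid R} {π : (P →₀ R) →ₗ[R] Q}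
    {ι : LinearMap.ker π →ₗ[R] (J →₀ R)} {ρ : (J →₀ R) →ₗ[R] LinearMap.ker π} {p₀ : P}
    (hρι : ∀ l, ρ (ι l) = l) (hπ : Function.Surjective π) (hp₀ : π (Finsupp.single p₀ 1) = 1)
    (hinv : ∀ t ∈ S, ∃ u : Q, t • u = 1)
    {S' : Submonoid R} {I' : Set P} {J' : Set J} (h : Tri S π ι ρ p₀ S' I' J') :
    GoodSub Q S S' := by
  intro T hT
  classical
  -- the retraction
  let p : LinearMap.ker π →ₗ[R] LinearMap.ker π :=
    ρ ∘ₗ (Finsupp.supported R R J').subtype ∘ₗ Finsupp.restrictDom R R J' ∘ₗ ι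
  have hp1 : ∀ l, (p l : P →₀ R) ∈ Finsupp.supported R R I' := by
    intro l
    exact supported_map ((LinearMap.ker π).subtype ∘ₗ ρ) _ h.hρ
      (Finsupp.restrictDom R R J' (ι l)).2
  have hp2 : ∀ l : LinearMap.ker π, (l : P →₀ R) ∈ Finsupp.supported R R I' → p l = l := by
    intro l hl
    have : ((Finsupp.restrictDom R R J' (ι l) : Finsupp.supported R R J') : J →₀ R) = ι l := by
      have h1 := h.hι l hl
      rw [Finsupp.restrictDom_apply]
      exact (Finsupp.filter_eq_self_iff _ _).2 (fun x hx => h1 (Finsupp.mem_support_iff.2 hx))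
    simp only [p, LinearMap.comp_apply, Submodule.subtype_apply, this, hρι]
  -- division by T on the free module
  obtain ⟨u, hu⟩ := hinv T hT
  choose v hv using fun i : P => hπ (u * π (Finsupp.single i 1))
  let θ : (P →₀ R) →ₗ[R] (P →₀ R) := Finsupp.linearCombination R v
  have hθ : ∀ g, T • π (θ g) = π g := by
    intro g
    have : (LinearMap.lsmul R Q T) ∘ₗ π ∘ₗ θ = π := by
      apply Finsupp.lhom_ext'
      intro i
      apply LinearMap.ext_ring
      simp only [θ, LinearMap.comp_apply, Finsupp.lsingle_apply, Finsupp.linearCombination_single,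
        one_smul, hv, LinearMap.lsmul_apply]
      rw [← smul_mul_assoc, hu, one_mul]
    exact congrArg (fun F => F g) this
  let δ : (P →₀ R) →ₗ[R] LinearMap.ker π :=
    LinearMap.codRestrict _ (LinearMap.id - T • θ) (by
      intro g
      simp [hθ])
  let k : (P →₀ R) →ₗ[R] (P →₀ R) := LinearMap.id - (LinearMap.ker π).subtype ∘ₗ p ∘ₗ δ
  have hk0 : ∀ g, k g = g - (p (δ g) : P →₀ R) := fun g => rfl
  have hk1 : ∀ g, π (k g) = π g := by
    intro g
    rw [hk0, map_sub, LinearMap.mem_ker.1 (p (δ g)).2, sub_zero]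
  have hk2 : ∀ g ∈ Finsupp.supported R R I', k g ∈ Finsupp.supported R R I' := by
    intro g hg
    rw [hk0]
    exact Submodule.sub_mem _ hg (hp1 _)
  have hk3 : ∀ l ∈ Finsupp.supported R R I', π l = 0 →
      ∃ w ∈ Finsupp.supported R R I', k l = T • w := by
    intro l hl hl0
    have hθl : π (θ l) = 0 := by
      apply cancel_of_inv ⟨u, hu⟩
      rw [hθ, hl0, smul_zero]
    replace hθl := LinearMap.mem_ker.2 hθl
    replace hl0 := LinearMap.mem_ker.2 hl0
    refine ⟨p ⟨θ l, hθl⟩, hp1 _, ?_⟩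
    have h1 : (⟨l, hl0⟩ : LinearMap.ker π) = δ l + T • (⟨θ l, hθl⟩ : LinearMap.ker π) := by
      apply Subtype.ext
      exact (sub_add_cancel l (T • θ l)).symm
    have h2 := congrArg (fun z => (p z : P →₀ R)) h1
    simp only [map_add, map_smul, hp2 ⟨l, hl0⟩ hl, Submodule.coe_add, Submodule.coe_smul] at h2
    rw [hk0, sub_eq_iff_eq_add, add_comm]
    exact h2
  set e₀ : P →₀ R := Finsupp.single p₀ 1 with he₀
  have he₀I : e₀ ∈ Finsupp.supported R R I' := Finsupp.single_mem_supported R _ h.p0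
  set a := k e₀ with ha
  have haI : a ∈ Finsupp.supported R R I' := hk2 _ he₀I
  have hπa : π a = 1 := by rw [ha, hk1, hp₀]
  have hsI : ∀ i ∈ a.support, π (Finsupp.single i 1) ∈ locSub Q S' := fun i hi =>
    h.hI i (haI hi)
  -- common denominator
  have hden : ∃ s ∈ S', ∀ i ∈ a.support, ∃ r : R,
      s • π (Finsupp.single i 1) = algebraMap R Q r := by
    choose! s hs r hr using hsI
    refine ⟨∏ i ∈ a.support, s i, S'.prod_mem hs, fun i hi => ?_⟩
    rw [← Finset.prod_erase_mul _ _ hi, mul_smul, hr i hi]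
    exact ⟨(∏ x ∈ a.support.erase i, s x) * r i, by rw [Algebra.smul_def, map_mul]⟩
  obtain ⟨s₀, hs₀, hden⟩ := hden
  choose! r₀ hr₀ using hden
  -- first consequence
  have hfin : ∀ x ∈ locSub Q S', ∃ v : P → R, ∃ y ∈ locSub Q S',
      x = ∑ i ∈ a.support, v i • π (Finsupp.single i 1) + T • y := by
    intro x hx
    obtain ⟨s, hs, c, hc⟩ := id hx
    obtain ⟨us, hus⟩ := hinv s (h.le hs)
    obtain ⟨g, hg, hgx⟩ := h.hsurj x hx
    obtain ⟨w, hw, hkw⟩ := hk3 (s • g - c • e₀)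
      (Submodule.sub_mem _ (Submodule.smul_mem _ _ hg) (Submodule.smul_mem _ _ he₀I))
      (by rw [map_sub, map_smul, map_smul, hgx, hp₀, hc, Algebra.algebraMap_eq_smul_one, sub_self])
    rw [map_sub, map_smul, map_smul, ← ha] at hkw
    have hco : ∀ i, s * (k g) i - c * a i = T * w i := by
      intro i
      have := congrArg (fun F : P →₀ R => F i) hkw
      simpa using this
    refine ⟨k g, - ∑ i ∈ a.support, (w i • us) * π (Finsupp.single i 1), ?_, ?_⟩
    · refine Submodule.neg_mem _ (Submodule.sum_mem _ fun i hi => mul_mem_locSub ?_ (hsI i hi))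
      exact Submodule.smul_mem _ _ (inv_mem_locSub hs hus)
    · have : x = ∑ i ∈ a.support, x * (a i • π (Finsupp.single i 1)) := by
        rw [← Finset.mul_sum, ← pi_eq_sum π a subset_rfl, hπa, mul_one]
      conv_lhs => rw [this]
      rw [smul_neg, ← sub_eq_add_neg, Finset.smul_sum, ← Finset.sum_sub_distrib]
      refine Finset.sum_congr rfl fun i _ => ?_
      apply cancel_of_inv ⟨us, hus⟩
      have h1 := congrArg (algebraMap R Q) (hco i)
      simp only [map_sub, map_mul] at h1
      simp only [Algebra.smul_def] at hc hus ⊢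
      linear_combination (algebraMap R Q (a i) * π (Finsupp.single i 1)) * hc
        - π (Finsupp.single i 1) * h1
        + algebraMap R Q T * algebraMap R Q (w i) * π (Finsupp.single i 1) * hus
  have h1 : ∀ x ∈ locSub Q S', ∃ r : R, ∃ y ∈ locSub Q S', x = algebraMap R Q r + T • y := by
    intro x hx
    obtain ⟨us, hus⟩ := hinv s₀ (h.le hs₀)
    obtain ⟨v, y, hy, hxy⟩ := hfin (us * x) (mul_mem_locSub (inv_mem_locSub hs₀ hus) hx)
    refine ⟨∑ i ∈ a.support, v i * r₀ i, s₀ • y, Submodule.smul_mem _ _ hy, ?_⟩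
    calc x = s₀ • (us * x) := by rw [← smul_mul_assoc, hus, one_mul]
      _ = _ := by
        rw [hxy, smul_add, smul_comm s₀ T, Finset.smul_sum, map_sum]
        congr 1
        refine Finset.sum_congr rfl fun i hi => ?_
        rw [smul_comm, hr₀ i hi, map_mul, Algebra.smul_def]
  refine ⟨h1, ?_⟩
  have h2 : ∀ i ∈ a.support, ∃ r : R, ∃ y ∈ locSub Q S',
    π (Finsupp.single i 1) = algebraMap R Q r + T • y := fun i hi => h1 _ (hsI i hi)
  choose! q y hy hq using h2
  refine ⟨∑ i ∈ a.support, a i * q i, ∑ i ∈ a.support, a i • y i,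
    Submodule.sum_mem _ fun i hi => Submodule.smul_mem _ _ (hy i hi), ?_, ?_⟩
  · rw [map_sub, map_one, ← hπa, pi_eq_sum π a subset_rfl, map_sum, Finset.smul_sum,
      ← Finset.sum_sub_distrib]
    refine Finset.sum_congr rfl fun i hi => ?_
    rw [hq i hi]
    simp only [Algebra.smul_def, map_mul]
    ring
  · intro r z hz hrz
    obtain ⟨g, hg, hgz⟩ := h.hsurj z hz
    obtain ⟨w, hw, hkw⟩ := hk3 (r • e₀ - T • g)
      (Submodule.sub_mem _ (Submodule.smul_mem _ _ he₀I) (Submodule.smul_mem _ _ hg))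
      (by rw [map_sub, map_smul, map_smul, hgz, hp₀, ← hrz, Algebra.algebraMap_eq_smul_one,
        sub_self])
    rw [map_sub, map_smul, map_smul, ← ha] at hkw
    have hco : ∀ i, r * a i - T * (k g) i = T * w i := by
      intro i
      have := congrArg (fun F : P →₀ R => F i) hkw
      simpa using this
    refine ⟨∑ i ∈ a.support, ((k g) i + w i) * q i, ?_⟩
    rw [Finset.sum_mul, Finset.mul_sum]
    refine Finset.sum_congr rfl fun i _ => ?_
    linear_combination q i * hco i

theorem countable_closure {W : Type u} (c : W → W → Set W) (hc : ∀ a b, (c a b).Countable)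
    (Y₀ : Set W) (hY₀ : Y₀.Countable) :
    ∃ Y : Set W, Y₀ ⊆ Y ∧ Y.Countable ∧ ∀ a ∈ Y, ∀ b ∈ Y, c a b ⊆ Y := by
  let F : Set W → Set W := fun Y => Y ∪ ⋃ a ∈ Y, ⋃ b ∈ Y, c a b
  have hF : ∀ Y : Set W, Y.Countable → (F Y).Countable := fun Y hY =>
    hY.union (hY.biUnion fun a _ => hY.biUnion fun b _ => hc a b)
  let G : ℕ → Set W := fun n => F^[n] Y₀
  have hGs : ∀ n, G (n + 1) = F (G n) := fun n => Function.iterate_succ_apply' F n Y₀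
  have hG : ∀ n, (G n).Countable := by
    intro n
    induction n with
    | zero => exact hY₀
    | succ n ih => rw [hGs]; exact hF _ ih
  have hmono : Monotone G := monotone_nat_of_le_succ fun n => by
    rw [hGs]; exact Set.subset_union_left
  refine ⟨⋃ n, G n, Set.subset_iUnion G 0, Set.countable_iUnion hG, ?_⟩
  intro a ha b hb x hx
  obtain ⟨n, hn⟩ := Set.mem_iUnion.1 ha
  obtain ⟨m, hm⟩ := Set.mem_iUnion.1 hb
  refine Set.mem_iUnion.2 ⟨max n m + 1, ?_⟩
  rw [hGs]
  refine Or.inr ?_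
  simp only [Set.mem_iUnion]
  exact ⟨a, hmono (le_max_left _ _) hn, b, hmono (le_max_right _ _) hm, hx⟩

theorem Tri.step {S : Submonoid R} {π : (P →₀ R) →ₗ[R] Q}
    {ι : LinearMap.ker π →ₗ[R] (J →₀ R)} {ρ : (J →₀ R) →ₗ[R] LinearMap.ker π} {p₀ : P}
    (hρι : ∀ l, ρ (ι l) = l) (hπ : Function.Surjective π) (hp₀ : π (Finsupp.single p₀ 1) = 1)
    (hinv : ∀ t ∈ S, ∃ u : Q, t • u = 1)
    (hfrac : ∀ x : Q, ∃ s ∈ S, ∃ r : R, s • x = algebraMap R Q r)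
    {S' : Submonoid R} {I' : Set P} {J' : Set J} (h : Tri S π ι ρ p₀ S' I' J')
    (t₀ : R) (ht₀ : t₀ ∈ S) :
    ∃ (X : Submonoid R) (I'' : Set P) (J'' : Set J), X ≤ S ∧ (X : Set R).Countable ∧ t₀ ∈ X ∧
      I' ⊆ I'' ∧ J' ⊆ J'' ∧ Tri S π ι ρ p₀ (S' ⊔ X) I'' J'' := by
  classical
  have hgood := h.good hρι hπ hp₀ hinv
  set e₀ : P →₀ R := Finsupp.single p₀ 1 with he₀
  have he₀I : e₀ ∈ Finsupp.supported R R I' := Finsupp.single_mem_supported R _ h.p0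
  choose inv hinv' using fun t : S => hinv t.1 t.2
  choose lam hlam using fun t : S => hπ (inv t)
  have hlamT : ∀ t : S, (t : R) • π (lam t) = 1 := fun t => by rw [hlam, hinv']
  choose d hdS c hc using fun i : P => hfrac (π (Finsupp.single i 1))
  choose hg1 e y₀ hy₀ hey hk using fun T : S => hgood T.1 T.2
  choose mu hmuI hmu using fun T : S => h.hsurj (y₀ T) (hy₀ T)
  let dd : P → S := fun i => ⟨d i, hdS i⟩
  -- the relations
  let ra : P → LinearMap.ker π := fun i => ⟨Finsupp.single i 1 - c i • lam (dd i), by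
    rw [LinearMap.mem_ker, map_sub, map_smul, sub_eq_zero]
    apply cancel_of_inv (hinv _ (hdS i))
    rw [hc, smul_comm]
    have := hlamT (dd i)
    change d i • _ = _ at this
    rw [this, Algebra.algebraMap_eq_smul_one]⟩
  let rs : S → S → LinearMap.ker π := fun t u => ⟨lam t - (u : R) • lam (t * u), by
    rw [LinearMap.mem_ker, map_sub, map_smul, sub_eq_zero]
    apply cancel_of_inv (hinv _ t.2)
    rw [hlamT, ← mul_smul]
    exact (hlamT (t * u)).symm⟩
  let rt : S → LinearMap.ker π := fun T => ⟨(1 - e T) • lam T - mu T, by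
    rw [LinearMap.mem_ker, map_sub, map_smul, sub_eq_zero]
    apply cancel_of_inv (hinv _ T.2)
    rw [smul_comm, hlamT, hmu, ← hey, Algebra.algebraMap_eq_smul_one]⟩
  let rone : S → LinearMap.ker π := fun T => ⟨(T : R) • lam T - e₀, by
    rw [LinearMap.mem_ker, map_sub, map_smul, sub_eq_zero, hlamT, hp₀]⟩
  -- closing off
  let aS : S → Set (S ⊕ P ⊕ J) := fun t => (fun i => Sum.inr (Sum.inl i)) '' ((lam t).support : Set P)
  let jS : LinearMap.ker π → Set (S ⊕ P ⊕ J) :=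
    fun l => (fun j => Sum.inr (Sum.inr j)) '' ((ι l).support : Set J)
  let cl : (S ⊕ P ⊕ J) → (S ⊕ P ⊕ J) → Set (S ⊕ P ⊕ J)
    | .inl t, .inl u => {Sum.inl (t * u)} ∪ aS t ∪ jS (rs t u) ∪ jS (rt t) ∪ jS (rone t)
    | .inr (.inl i), _ => {Sum.inl (dd i)} ∪ jS (ra i)
    | .inr (.inr j), _ =>
      (fun i => Sum.inr (Sum.inl i)) '' ((ρ (Finsupp.single j 1) : P →₀ R).support : Set P)
    | .inl _, .inr _ => ∅
  have haS : ∀ t, (aS t).Countable := fun t => ((lam t).support.countable_toSet).image _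
  have hjS : ∀ l, (jS l).Countable := fun l => ((ι l).support.countable_toSet).image _
  have hcl : ∀ a b, (cl a b).Countable := by
    rintro (t | i | j) (u | b)
    · exact ((((Set.countable_singleton _).union (haS t)).union (hjS _)).union (hjS _)).union (hjS _)
    · exact Set.countable_empty
    · exact (Set.countable_singleton _).union (hjS _)
    · exact (Set.countable_singleton _).union (hjS _)
    · exact ((ρ (Finsupp.single j 1) : P →₀ R).support.countable_toSet).image _
    · exact ((ρ (Finsupp.single j 1) : P →₀ R).support.countable_toSet).image _
  obtain ⟨Y, hY0, hYc, hY⟩ := countable_closure cl hcl {Sum.inl 1, Sum.inl ⟨t₀, ht₀⟩}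
    (Set.toFinite _).countable
  have h1Y : Sum.inl 1 ∈ Y := hY0 (by simp)
  let X₀ : Submonoid S :=
    { carrier := {t | Sum.inl t ∈ Y}
      one_mem' := h1Y
      mul_mem' := fun {t u} ht hu => hY _ ht _ hu (Or.inl (Or.inl (Or.inl (Or.inl rfl)))) }
  let X : Submonoid R := X₀.map S.subtype
  have hX₀c : (X₀ : Set S).Countable := hYc.preimage Sum.inl_injective
  let YI : Set P := {i | Sum.inr (Sum.inl i) ∈ Y}
  let YJ : Set J := {j | Sum.inr (Sum.inr j) ∈ Y}
  have hXlam : ∀ t ∈ X₀, lam t ∈ Finsupp.supported R R YI := fun t ht i hi =>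
    hY _ ht _ ht (Or.inl (Or.inl (Or.inl (Or.inr ⟨i, hi, rfl⟩))))
  have hXs : ∀ t ∈ X₀, ∀ u ∈ X₀, ι (rs t u) ∈ Finsupp.supported R R YJ := fun t ht u hu j hj =>
    hY _ ht _ hu (Or.inl (Or.inl (Or.inr ⟨j, hj, rfl⟩)))
  have hXt : ∀ t ∈ X₀, ι (rt t) ∈ Finsupp.supported R R YJ := fun t ht j hj =>
    hY _ ht _ ht (Or.inl (Or.inr ⟨j, hj, rfl⟩))
  have hXw : ∀ t ∈ X₀, ι (rone t) ∈ Finsupp.supported R R YJ := fun t ht j hj =>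
    hY _ ht _ ht (Or.inr ⟨j, hj, rfl⟩)
  have hYd : ∀ i ∈ YI, dd i ∈ X₀ := fun i hi => hY _ hi _ hi (Or.inl rfl)
  have hYa : ∀ i ∈ YI, ι (ra i) ∈ Finsupp.supported R R YJ := fun i hi j hj =>
    hY _ hi _ hi (Or.inr ⟨j, hj, rfl⟩)
  have hYρ : ∀ j ∈ YJ, (ρ (Finsupp.single j 1) : P →₀ R) ∈ Finsupp.supported R R YI :=
    fun j hj i hi => hY _ hj _ hj ⟨i, hi, rfl⟩
  have hXX : ∀ t ∈ X₀, (t : R) ∈ X := fun t ht => ⟨t, ht, rfl⟩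
  have hsubI : Finsupp.supported R R I' ≤ Finsupp.supported R R (I' ∪ YI) :=
    Finsupp.supported_mono Set.subset_union_left
  have hsubI2 : Finsupp.supported R R YI ≤ Finsupp.supported R R (I' ∪ YI) :=
    Finsupp.supported_mono Set.subset_union_right
  have hsubJ : Finsupp.supported R R J' ≤ Finsupp.supported R R (J' ∪ YJ) :=
    Finsupp.supported_mono Set.subset_union_left
  have hsubJ2 : Finsupp.supported R R YJ ≤ Finsupp.supported R R (J' ∪ YJ) :=
    Finsupp.supported_mono Set.subset_union_right
  have hXS : X ≤ S := by
    rintro _ ⟨t, _, rfl⟩; exact t.2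
  refine ⟨X, I' ∪ YI, J' ∪ YJ, hXS, hX₀c.image _, ⟨⟨t₀, ht₀⟩, hY0 (by simp), rfl⟩,
    Set.subset_union_left, Set.subset_union_left, ?_⟩
  refine ⟨sup_le h.le hXS, Or.inl h.p0, ?_, ?_, ?_, ?_⟩
  · rintro i (hi | hi)
    · exact locSub_mono le_sup_left (h.hI i hi)
    · exact locSub_mono le_sup_right ⟨d i, hXX _ (hYd i hi), c i, hc i⟩
  · rintro x ⟨s, hs, r, hr⟩
    obtain ⟨a, ha, _, ⟨T, hT, rfl⟩, rfl⟩ := Submonoid.mem_sup.1 hs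
    have hTx : (T : R) • x ∈ locSub Q S' := ⟨a, ha, r, by rw [← mul_smul]; exact hr⟩
    obtain ⟨q, y, hy, hq⟩ := hg1 T _ hTx
    obtain ⟨g, hg, hgy⟩ := h.hsurj y hy
    refine ⟨q • lam T + g, Submodule.add_mem _ (Submodule.smul_mem _ _ (hsubI2 (hXlam T hT)))
      (hsubI hg), ?_⟩
    apply cancel_of_inv (hinv _ T.2)
    rw [hq, map_add, map_smul, hgy, smul_add, smul_comm, hlamT, Algebra.algebraMap_eq_smul_one]
  · rintro j (hj | hj)
    · exact hsubI (h.hρ j hj)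
    · exact hsubI2 (hYρ j hj)
  · let M₀ : Submodule R (LinearMap.ker π) := (Finsupp.supported R R (J' ∪ YJ)).comap ι
    let M : Submodule R (P →₀ R) := M₀.map (LinearMap.ker π).subtype
    have hM : ∀ l : LinearMap.ker π, ι l ∈ Finsupp.supported R R (J' ∪ YJ) → (l : P →₀ R) ∈ M :=
      fun l hl => ⟨l, hl, rfl⟩
    have hMπ : ∀ m ∈ M, π m = 0 := by
      rintro _ ⟨l, _, rfl⟩; exact l.2
    -- decomposition
    let N : Submodule R (P →₀ R) :=
      { carrier := {v | ∃ v' ∈ Finsupp.supported R R I', ∃ T ∈ X₀, ∃ r : R, ∃ m ∈ M,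
          v = v' + r • lam T + m}
        zero_mem' := ⟨0, Submodule.zero_mem _, 1, X₀.one_mem, 0, 0, Submodule.zero_mem _, by simp⟩
        add_mem' := by
          rintro _ _ ⟨v, hv, T, hT, r, m, hm, rfl⟩ ⟨v', hv', T', hT', r', m', hm', rfl⟩
          have k1 := hM _ (hsubJ2 (hXs T hT T' hT'))
          have k2 := hM _ (hsubJ2 (hXs T' hT' T hT))
          refine ⟨v + v', Submodule.add_mem _ hv hv', T * T', X₀.mul_mem hT hT',
            r * T' + r' * T, m + m' + r • (rs T T' : P →₀ R) + r' • (rs T' T : P →₀ R), ?_, ?_⟩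
          · exact Submodule.add_mem _ (Submodule.add_mem _ (Submodule.add_mem _ hm hm')
              (Submodule.smul_mem _ _ k1)) (Submodule.smul_mem _ _ k2)
          · simp only [rs, mul_comm T' T]
            module
        smul_mem' := by
          rintro a _ ⟨v, hv, T, hT, r, m, hm, rfl⟩
          refine ⟨a • v, Submodule.smul_mem _ _ hv, T, hT, a * r, a • m, Submodule.smul_mem _ _ hm, ?_⟩
          module }
    intro l hl
    have hlN : (l : P →₀ R) ∈ N := by
      refine supported_map LinearMap.id N ?_ hl
      rintro i (hi | hi)
      · exact ⟨Finsupp.single i 1, Finsupp.single_mem_supported R _ hi, 1, X₀.one_mem, 0, 0,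
          Submodule.zero_mem _, by simp⟩
      · refine ⟨0, Submodule.zero_mem _, dd i, hYd i hi, c i, ra i, hM _ (hsubJ2 (hYa i hi)), ?_⟩
        simp [ra]
    obtain ⟨v', hv', T, hT, r, m, hm, hlv⟩ := hlN
    have hπl : π v' + r • π (lam T) = 0 := by
      have := l.2
      rw [LinearMap.mem_ker, hlv, map_add, map_add, map_smul, hMπ m hm, add_zero] at this
      exact this
    have hπv' : π v' ∈ locSub Q S' := supported_map π _ h.hI hv'
    obtain ⟨w, hw⟩ := hk T r (-π v') (Submodule.neg_mem _ hπv') (by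
      rw [← eq_neg_of_add_eq_zero_right hπl, smul_comm, hlamT, Algebra.algebraMap_eq_smul_one])
    -- reduce to an old relation
    set z : P →₀ R := v' + w • e₀ + r • mu T with hz
    have hzI : z ∈ Finsupp.supported R R I' :=
      Submodule.add_mem _ (Submodule.add_mem _ hv' (Submodule.smul_mem _ _ he₀I))
        (Submodule.smul_mem _ _ (hmuI T))
    have hlz : (l : P →₀ R) = z + (w • (rone T : P →₀ R) + r • (rt T : P →₀ R) + m) := by
      rw [hlv, hz]
      have : r • lam T = (T * w : R) • lam T + (r - e T * r) • lam T := by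
        rw [← hw]; module
      rw [this]
      simp only [rone, rt]
      module
    have hmM : w • (rone T : P →₀ R) + r • (rt T : P →₀ R) + m ∈ M :=
      Submodule.add_mem _ (Submodule.add_mem _ (Submodule.smul_mem _ _ (hM _ (hsubJ2 (hXw T hT))))
        (Submodule.smul_mem _ _ (hM _ (hsubJ2 (hXt T hT))))) hm
    have hzker : z ∈ LinearMap.ker π := by
      have := l.2
      rw [LinearMap.mem_ker, hlz, map_add, hMπ _ hmM, add_zero] at this
      exact this
    have hzM : z ∈ M := hM ⟨z, hzker⟩ (hsubJ (h.hι ⟨z, hzker⟩ hzI))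
    have hlM : (l : P →₀ R) ∈ M := hlz ▸ Submodule.add_mem _ hzM hmM
    obtain ⟨l', hl', hll⟩ := hlM
    obtain rfl : l' = l := Subtype.ext hll
    exact hl'

theorem directed_mem_supported {A : Type u} {ℐ : Type u} (I : ℐ → Set A) [Nonempty ℐ]
    (hI : Directed (· ≤ ·) I) {g : A →₀ R} (hg : g ∈ Finsupp.supported R R (⋃ i, I i)) :
    ∃ i, g ∈ Finsupp.supported R R (I i) := by
  have := (hI.exists_mem_subset_of_finset_subset_biUnion (s := g.support) hg)
  exact this

/-- Unions of directed families of closed triples. -/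
theorem Tri.iUnion {S : Submonoid R} {π : (P →₀ R) →ₗ[R] Q}
    {ι : LinearMap.ker π →ₗ[R] (J →₀ R)} {ρ : (J →₀ R) →ₗ[R] LinearMap.ker π} {p₀ : P}
    {ℐ : Type u} [Nonempty ℐ] (A : ℐ → Submonoid R) (B : ℐ → Set P) (C : ℐ → Set J)
    (hA : Directed (· ≤ ·) A) (hB : Directed (· ≤ ·) B)
    (h : ∀ i, Tri S π ι ρ p₀ (A i) (B i) (C i)) :
    Tri S π ι ρ p₀ (⨆ i, A i) (⋃ i, B i) (⋃ i, C i) := by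
  have hle : ∀ i, locSub Q (A i) ≤ locSub Q (⨆ i, A i) := fun i => locSub_mono (le_iSup A i)
  refine ⟨iSup_le fun i => (h i).le, ?_, ?_, ?_, ?_, ?_⟩
  · obtain ⟨i⟩ := ‹Nonempty ℐ›
    exact Set.mem_iUnion.2 ⟨i, (h i).p0⟩
  · intro x hx
    obtain ⟨i, hi⟩ := Set.mem_iUnion.1 hx
    exact hle i ((h i).hI x hi)
  · rintro x ⟨s, hs, r, hr⟩
    obtain ⟨i, hi⟩ := (Submonoid.mem_iSup_of_directed hA).1 hs
    obtain ⟨g, hg, hgx⟩ := (h i).hsurj x ⟨s, hi, r, hr⟩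
    exact ⟨g, Finsupp.supported_mono (Set.subset_iUnion B i) hg, hgx⟩
  · intro j hj
    obtain ⟨i, hi⟩ := Set.mem_iUnion.1 hj
    exact Finsupp.supported_mono (Set.subset_iUnion B i) ((h i).hρ j hi)
  · intro l hl
    obtain ⟨i, hi⟩ := directed_mem_supported B hB hl
    exact Finsupp.supported_mono (Set.subset_iUnion C i) ((h i).hι l hi)

theorem exists_extension {S : Submonoid R} {π : (P →₀ R) →ₗ[R] Q}
    {ι : LinearMap.ker π →ₗ[R] (J →₀ R)} {ρ : (J →₀ R) →ₗ[R] LinearMap.ker π} {p₀ : P}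
    (hρι : ∀ l, ρ (ι l) = l) (hπ : Function.Surjective π) (hp₀ : π (Finsupp.single p₀ 1) = 1)
    (hinj : Function.Injective (algebraMap R Q))
    (hinv : ∀ t ∈ S, ∃ u : Q, t • u = 1)
    (hfrac : ∀ x : Q, ∃ s ∈ S, ∃ r : R, s • x = algebraMap R Q r)
    (hD : ∀ s ∈ S, ∀ m : D, ∃ x : D, s • x = m) (m : D) :
    ∃ f : Q →ₗ[R] D, f 1 = m := by
  let E := (Submonoid R × Set P × Set J) × (Q →ₗ.[R] D)
  let Z : Set E := {z | Tri S π ι ρ p₀ z.1.1 z.1.2.1 z.1.2.2 ∧ z.2.domain = locSub Q z.1.1}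
  -- initial element
  have hbot : ∀ x : Q, x ∈ locSub Q (⊥ : Submonoid R) ↔ ∃ r : R, algebraMap R Q r = x := by
    intro x
    constructor
    · rintro ⟨s, hs, r, hr⟩
      obtain rfl := Submonoid.mem_bot.1 hs
      exact ⟨r, by rw [← hr, one_smul]⟩
    · rintro ⟨r, rfl⟩
      exact algebraMap_mem_locSub _ r
  let eq₀ : R ≃ₗ[R] LinearMap.range (Algebra.linearMap R Q) :=
    LinearEquiv.ofInjective (Algebra.linearMap R Q) hinj
  let f₀ : Q →ₗ.[R] D := ⟨LinearMap.range (Algebra.linearMap R Q),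
    (LinearMap.toSpanSingleton R D m) ∘ₗ eq₀.symm.toLinearMap⟩
  have h1dom : (1 : Q) ∈ f₀.domain := ⟨1, by simp⟩
  have hf₀1 : f₀ ⟨1, h1dom⟩ = m := by
    change (LinearMap.toSpanSingleton R D m) (eq₀.symm ⟨1, h1dom⟩) = m
    have : eq₀.symm ⟨1, h1dom⟩ = 1 := by
      rw [LinearEquiv.symm_apply_eq]
      apply Subtype.ext
      exact (map_one (algebraMap R Q)).symm
    rw [this]; simp
  have hz₀ : (((⊥, {p₀}, ∅), f₀) : E) ∈ Z := by
    refine ⟨⟨bot_le, rfl, ?_, ?_, ?_, ?_⟩, ?_⟩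
    · rintro i rfl
      rw [hp₀]; exact one_mem_locSub _
    · intro x hx
      obtain ⟨r, rfl⟩ := (hbot x).1 hx
      refine ⟨r • Finsupp.single p₀ 1, Submodule.smul_mem _ _ (Finsupp.single_mem_supported R _ rfl), ?_⟩
      rw [map_smul, hp₀, Algebra.algebraMap_eq_smul_one]
    · intro j hj; exact hj.elim
    · intro l hl
      have : l = 0 := by
        apply Subtype.ext
        have h1 : (l : P →₀ R) = Finsupp.single p₀ ((l : P →₀ R) p₀) :=
          Finsupp.support_subset_singleton.1 (by
            intro x hx
            have : x ∈ ({p₀} : Set P) := hl hx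
            simpa using this)
        have h2 := l.2
        rw [LinearMap.mem_ker, h1] at h2
        have h3 : Finsupp.single p₀ ((l : P →₀ R) p₀) = (l : P →₀ R) p₀ • Finsupp.single p₀ 1 := by
          simp
        rw [h3, map_smul, hp₀, ← Algebra.algebraMap_eq_smul_one] at h2
        have h4 : (l : P →₀ R) p₀ = 0 := hinj (by rw [h2, map_zero])
        rw [h1, h4]; simp
      rw [this, map_zero]
      exact Submodule.zero_mem _
    · ext x
      rw [hbot]
      rfl
  obtain ⟨z, hle, hmax⟩ := zorn_le_nonempty₀ Z (by
    intro c hcZ hc y hy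
    have : Nonempty c := ⟨⟨y, hy⟩⟩
    have hdir : Directed (· ≤ ·) (fun i : c => (i : E)) := hc.directed
    have hdirf : DirectedOn (· ≤ ·) ((fun i : E => i.2) '' c) := by
      rintro _ ⟨a, ha, rfl⟩ _ ⟨b, hb, rfl⟩
      obtain ⟨d, h1, h2⟩ := hdir ⟨a, ha⟩ ⟨b, hb⟩
      exact ⟨d.1.2, ⟨d.1, d.2, rfl⟩, h1.2, h2.2⟩
    have hA : Directed (· ≤ ·) (fun i : c => i.1.1.1) := fun a b => by
      obtain ⟨d, h1, h2⟩ := hdir a b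
      exact ⟨d, h1.1.1, h2.1.1⟩
    have hB : Directed (· ≤ ·) (fun i : c => i.1.1.2.1) := fun a b => by
      obtain ⟨d, h1, h2⟩ := hdir a b
      exact ⟨d, h1.1.2.1, h2.1.2.1⟩
    refine ⟨((⨆ i : c, i.1.1.1, ⋃ i : c, i.1.1.2.1, ⋃ i : c, i.1.1.2.2),
      LinearPMap.sSup _ hdirf), ⟨?_, ?_⟩, ?_⟩
    · exact Tri.iUnion _ _ _ hA hB (fun i => (hcZ i.2).1)
    · ext x
      rw [LinearPMap.mem_domain_sSup_iff (Set.Nonempty.image _ ⟨y, hy⟩) hdirf]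
      constructor
      · rintro ⟨_, ⟨a, ha, rfl⟩, hx⟩
        rw [(hcZ ha).2] at hx
        exact locSub_mono (le_iSup (fun i : c => i.1.1.1) ⟨a, ha⟩) hx
      · rintro ⟨s, hs, r, hr⟩
        obtain ⟨i, hi⟩ := (Submonoid.mem_iSup_of_directed hA).1 hs
        refine ⟨_, ⟨i.1, i.2, rfl⟩, ?_⟩
        rw [(hcZ i.2).2]
        exact ⟨s, hi, r, hr⟩
    · intro a ha
      exact ⟨⟨le_iSup (fun i : c => i.1.1.1) ⟨a, ha⟩,
        Set.subset_iUnion (fun i : c => i.1.1.2.1) ⟨a, ha⟩,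
        Set.subset_iUnion (fun i : c => i.1.1.2.2) ⟨a, ha⟩⟩,
        LinearPMap.le_sSup hdirf ⟨a, ha, rfl⟩⟩) _ hz₀
  obtain ⟨⟨A, B, C⟩, f⟩ := z
  have hZ := hmax.prop
  obtain ⟨hTri, hdom⟩ := hZ
  simp only at hTri hdom
  have hall : S ≤ A := by
    intro t ht
    obtain ⟨X, B', C', hXS, hXc, htX, hBB, hCC, hT'⟩ := hTri.step hρι hπ hp₀ hinv hfrac t ht
    obtain ⟨f', hff, hf'⟩ := good_ext_countable hinv (hTri.good hρι hπ hp₀ hinv) hD X hXS hXc f hdom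
    have := hmax.le_of_ge (y := ((A ⊔ X, B', C'), f')) ⟨hT', hf'⟩ ⟨⟨le_sup_left, hBB, hCC⟩, hff⟩
    exact this.1.1 (Submonoid.mem_sup_right htX)
  have htop : ∀ x : Q, x ∈ f.domain := by
    intro x
    rw [hdom]
    obtain ⟨s, hs, r, hr⟩ := hfrac x
    exact ⟨s, hall hs, r, hr⟩
  refine ⟨f.toFun ∘ₗ LinearMap.codRestrict f.domain LinearMap.id htop, ?_⟩
  rw [← hf₀1]
  exact (hle.2.2 (x := ⟨1, h1dom⟩) (y := ⟨1, htop 1⟩) rfl).symm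

theorem projective_of_surj {A B : Type u} [AddCommGroup A] [Module R A] [AddCommGroup B]
    [Module R B] (f : A →ₗ[R] B) (hf : Function.Surjective f) [Module.Projective R B]
    [Module.Projective R (LinearMap.ker f)] : Module.Projective R A := by
  obtain ⟨s, hs⟩ := Module.projective_lifting_property f LinearMap.id hf
  have hs' : ∀ b, f (s b) = b := fun b => congrArg (fun F => F b) hs
  let i : A →ₗ[R] LinearMap.ker f × B :=
    (LinearMap.codRestrict _ (LinearMap.id - s ∘ₗ f) (by intro a; simp [hs'])).prod f
  let j : LinearMap.ker f × B →ₗ[R] A := (LinearMap.ker f).subtype.coprod s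
  refine Module.Projective.of_split i j ?_
  ext a
  simp [i, j]

/-- Restriction of a surjection with projective domain and target to a preimage. -/
theorem projective_ker_comp {A B : Type u} [AddCommGroup A] [Module R A] [AddCommGroup B]
    [Module R B] {N : Type u} [AddCommGroup N] [Module R N]
    (q : A →ₗ[R] B) (hq : Function.Surjective q) (f : B →ₗ[R] N) [Module.Projective R A]
    [Module.Projective R B] [Module.Projective R (LinearMap.ker f)] :
    Module.Projective R (LinearMap.ker (f ∘ₗ q)) := by
  obtain ⟨s, hs⟩ := Module.projective_lifting_property q LinearMap.id hq
  have hs' : ∀ b, q (s b) = b := fun b => congrArg (fun F => F b) hs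
  have : Module.Projective R (LinearMap.ker q) := by
    refine Module.Projective.of_split (LinearMap.ker q).subtype
      (LinearMap.codRestrict _ (LinearMap.id - s ∘ₗ q) (by intro a; simp [hs'])) ?_
    ext a
    simp
  let q' : LinearMap.ker (f ∘ₗ q) →ₗ[R] LinearMap.ker f := q.restrict (fun x hx => hx)
  have hq' : Function.Surjective q' := by
    rintro ⟨b, hb⟩
    obtain ⟨a, rfl⟩ := hq b
    exact ⟨⟨a, hb⟩, rfl⟩
  let i : LinearMap.ker q' →ₗ[R] LinearMap.ker q :=
    LinearMap.codRestrict _ ((LinearMap.ker (f ∘ₗ q)).subtype ∘ₗ (LinearMap.ker q').subtype) (by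
      rintro ⟨a, ha⟩
      exact congrArg Subtype.val ha)
  have hker : ∀ a : LinearMap.ker q, f (q a) = 0 := fun a => by
    rw [LinearMap.mem_ker.1 a.2, map_zero]
  let j : LinearMap.ker q →ₗ[R] LinearMap.ker q' :=
    LinearMap.codRestrict _ (LinearMap.codRestrict _ (LinearMap.ker q).subtype hker) (by
      intro a
      rw [LinearMap.mem_ker]
      apply Subtype.ext
      exact a.2)
  have : Module.Projective R (LinearMap.ker q') := Module.Projective.of_split i j (by
    ext a
    rfl)
  exact projective_of_surj q' hq'

end GenLoc

/-- Let `R` be a domain and `S` a multiplicative set of nonzero elements with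
`pd_R(S⁻¹R) ≤ 1`. Then an `R`-module `M` is generated by `S⁻¹R` (an epimorphic image of
a direct sum of copies of `S⁻¹R`) iff `M` is `S`-divisible (`sM = M` for all `s ∈ S`). -/
theorem gen_localization_iff_S_divisible (R : Type u) [CommRing R] [IsDomain R]
    (S : Submonoid R) (hS : ∀ s ∈ S, s ≠ (0 : R))
    (hpd : ProjDimLE R 1 (ModuleCat.of R (Localization S)))
    (M : Type u) [AddCommGroup M] [Module R M] :
    (∃ (ι : Type u) (f : (ι →₀ Localization S) →ₗ[R] M), Function.Surjective f) ↔
      ∀ s ∈ S, ∀ m : M, ∃ x : M, s • x = m := by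
  have hinv : ∀ t ∈ S, ∃ u : Localization S, t • u = 1 := by
    intro t ht
    refine ⟨IsLocalization.mk' (Localization S) 1 (⟨t, ht⟩ : S), ?_⟩
    rw [Algebra.smul_def, mul_comm, IsLocalization.mk'_spec (Localization S) 1 (⟨t, ht⟩ : S), map_one]
  constructor
  · rintro ⟨ι, f, hf⟩ s hs m
    obtain ⟨x, rfl⟩ := hf m
    obtain ⟨u, hu⟩ := hinv s hs
    refine ⟨f (x.mapRange (fun y => u * y) (mul_zero u)), ?_⟩
    rw [← map_smul]
    congr 1
    ext i
    rw [Finsupp.smul_apply, Finsupp.mapRange_apply, ← smul_mul_assoc, hu, one_mul]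
  · intro hD
    have hinj : Function.Injective (algebraMap R (Localization S)) :=
      IsLocalization.injective _ (fun s hs => mem_nonZeroDivisors_of_ne_zero (hS s hs))
    have hfrac : ∀ x : Localization S, ∃ s ∈ S, ∃ r : R,
        s • x = algebraMap R (Localization S) r := by
      intro x
      obtain ⟨⟨r, s⟩, hx⟩ := IsLocalization.surj S x
      exact ⟨s, s.2, r, by rw [Algebra.smul_def, mul_comm]; exact hx⟩
    obtain ⟨P, f, hepi, hP, hK⟩ := hpd
    have hfs : Function.Surjective f.hom := (ModuleCat.epi_iff_surjective f).1 hepi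
    have : Module.Projective R P := (IsProjective.iff_projective P).2 hP
    have hK' : Projective (kernel f) := hK
    have : Module.Projective R (LinearMap.ker f.hom) := by
      rw [IsProjective.iff_projective]
      exact Projective.of_iso (ModuleCat.kernelIsoKer f) hK'
    let F : P →ₗ[R] Localization S := f.hom
    let q : (P →₀ R) →ₗ[R] P := Finsupp.linearCombination R id
    have hq : Function.Surjective q := fun p => ⟨Finsupp.single p 1, by simp [q]⟩
    have : Module.Projective R (LinearMap.ker F) := this
    have hL : Module.Projective R (LinearMap.ker (F ∘ₗ q)) := projective_ker_comp q hq F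
    obtain ⟨ι, hι⟩ := Module.projective_def'.1 hL
    obtain ⟨p₀, hp₀⟩ := hfs (1 : Localization S)
    have hext : ∀ m : M, ∃ g : Localization S →ₗ[R] M, g 1 = m := fun m =>
      exists_extension (S := S) (π := F ∘ₗ q) (ι := ι)
        (ρ := Finsupp.linearCombination R id) (p₀ := p₀)
        (fun l => congrArg (fun G => G l) hι) (hfs.comp hq) (by simpa [q, F] using hp₀)
        hinj hinv hfrac hD m
    choose g hg using hext
    refine ⟨M, Finsupp.lsum R g, fun m => ⟨Finsupp.single m 1, ?_⟩⟩
    simp [hg]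
end
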